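/- Let X and Y be complex Banach spaces such that X has type p₀ ∈ (1,2] and Y has cotype q₀ ∈ [2,∞). Let p ∈ (1,p₀) and q ∈ (q₀,∞) (one may take p = p₀ if p₀ = 2, and q = q₀ if q₀ = 2). Let m : ℝ^n \ {0} → L(X,Y) be strongly measurable, and assume the set { |ξ|^{n(1/p − 1/q)} m(ξ) : ξ ∈ ℝ^n \ {0} } is R-bounded in L(X,Y). Then m is a bounded (L^p, L^q) Fourier multiplier: there exists C ≥ 0 with ‖𝓕⁻¹(m · 𝓕 f)‖_{L^q(ℝ^n;Y)} ≤ C ‖f‖_{L^p(ℝ^n;X)} for every X-valued Schwartz function f. -/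

import Mathlib

open MeasureTheory FourierTransform SchwartzMap ENNReal

/-- The Rademacher sign associated to a boolean. -/
noncomputable def radSign (b : Bool) : ℝ := if b then 1 else -1

/-- The average of `F` over all sign choices `ε ∈ {−1,1}^N`, encoded by `ε : Fin N → Bool`. -/
noncomputable def radAvg (N : ℕ) (F : (Fin N → Bool) → ℝ) : ℝ :=
  (∑ ε : Fin N → Bool, F ε) / 2 ^ N

section Multiplier

open ProbabilityTheory

section Gaussian

/-- The `L²` norm of the Gaussian sum `∑ i, γ i • x i` with independent standard Gaussians `γ`. -/
noncomputable def gaussNorm {ι X : Type*} [Fintype ι] [NormedAddCommGroup X] [NormedSpace ℝ X]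
    (x : ι → X) : ℝ≥0∞ :=
  eLpNorm (fun ω : EuclideanSpace ℝ ι => ∑ i, ω i • x i) 2 (stdGaussian (EuclideanSpace ℝ ι))

variable {ι κ X : Type*} [Fintype ι] [Fintype κ] [NormedAddCommGroup X] [NormedSpace ℝ X]

lemma eLpNorm_two_sq {α E : Type*} [MeasurableSpace α] [NormedAddCommGroup E] (μ : Measure α)
    (f : α → E) : eLpNorm f 2 μ ^ 2 = ∫⁻ a, ‖f a‖ₑ ^ 2 ∂μ := by
  have := eLpNorm_nnreal_pow_eq_lintegral (f := f) (μ := μ) (p := 2) (by norm_num)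
  have h : ((2 : NNReal) : ℝ) = ((2 : ℕ) : ℝ) := by norm_num
  simp only [h, ENNReal.rpow_natCast] at this
  simpa using this

lemma gaussNorm_sq (x : ι → X) : gaussNorm x ^ 2 =
    ∫⁻ ω, ‖∑ i, ω i • x i‖ₑ ^ 2 ∂(stdGaussian (EuclideanSpace ℝ ι)) :=
  eLpNorm_two_sq _ _

lemma memLp_gaussSum (x : ι → X) : MemLp (fun ω : EuclideanSpace ℝ ι => ∑ i, ω i • x i) 2
    (stdGaussian (EuclideanSpace ℝ ι)) := by
  refine memLp_finsetSum _ fun i _ => ?_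
  have h : MemLp (fun ω : EuclideanSpace ℝ ι => ω i) 2 (stdGaussian (EuclideanSpace ℝ ι)) :=
    IsGaussian.memLp_dual _ (EuclideanSpace.proj (𝕜 := ℝ) i) 2 (by norm_num)
  exact ((ContinuousLinearMap.toSpanSingleton ℝ (x i)).comp_memLp' h)

lemma gaussNorm_ne_top (x : ι → X) : gaussNorm x ≠ ∞ := (memLp_gaussSum x).2.ne

lemma gaussNorm_add_le (x y : ι → X) : gaussNorm (x + y) ≤ gaussNorm x + gaussNorm y := by
  refine le_trans (le_of_eq ?_)
    (eLpNorm_add_le (memLp_gaussSum x).1 (memLp_gaussSum y).1 (by norm_num))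
  simp only [gaussNorm, Pi.add_apply, smul_add, Finset.sum_add_distrib]
  rfl

lemma gaussNorm_smul {𝕜 : Type*} [NormedField 𝕜] [NormedSpace 𝕜 X] [SMulCommClass ℝ 𝕜 X]
    (c : 𝕜) (x : ι → X) :
    gaussNorm (c • x) = ‖c‖ₑ * gaussNorm x := by
  rw [gaussNorm, gaussNorm, ← eLpNorm_const_smul]
  congr 1
  ext ω
  simp [Finset.smul_sum, smul_comm]

lemma gaussNorm_unique (x : Unit → X) : gaussNorm x = ‖x ()‖ₑ := by
  have h : ∫⁻ ω : EuclideanSpace ℝ Unit, ‖ω ()‖ₑ ^ 2 ∂stdGaussian (EuclideanSpace ℝ Unit) = 1 := by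
    rw [← map_pi_eq_stdGaussian, lintegral_map (by fun_prop) (by fun_prop)]
    have h2 := (measurePreserving_eval (μ := fun _ : Unit => gaussianReal 0 1) ())
    refine (h2.lintegral_comp (f := fun t : ℝ => ‖t‖ₑ ^ 2) (by fun_prop)).trans ?_
    have := variance_id_gaussianReal (μ := 0) (v := 1)
    have h3 := evariance_eq_lintegral_ofReal (id : ℝ → ℝ) (gaussianReal 0 1)
    rw [← IsGaussian.memLp_two_id.ofReal_variance_eq, this] at h3
    simp only [id, integral_id_gaussianReal, sub_zero, NNReal.coe_one, ofReal_one] at h3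
    rw [h3]
    refine lintegral_congr fun t => ?_
    rw [← ofReal_norm, ← ENNReal.ofReal_pow (norm_nonneg _), Real.norm_eq_abs, sq_abs]
  have h2 : gaussNorm x ^ 2 = ‖x ()‖ₑ ^ 2 := by
    rw [gaussNorm_sq]
    simp only [Finset.univ_unique, PUnit.default_eq_unit, Finset.sum_singleton, enorm_smul, mul_pow]
    rw [lintegral_mul_const _ (by fun_prop), h, one_mul]
  exact (ENNReal.pow_right_strictMono (n := 2) (by norm_num)).injective h2

/-- Gaussian sums as a continuous linear map into `L²`. -/
noncomputable def gaussSumLp (ι X : Type*) [Fintype ι] [NormedAddCommGroup X] [NormedSpace ℝ X] :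
    (ι → X) →L[ℝ] Lp X 2 (stdGaussian (EuclideanSpace ℝ ι)) :=
  LinearMap.mkContinuous
    { toFun := fun x => (memLp_gaussSum x).toLp
      map_add' := fun x y => by
        rw [← MemLp.toLp_add]
        congr 1
        ext ω
        simp [Finset.sum_add_distrib]
      map_smul' := fun c x => by
        rw [RingHom.id_apply, ← MemLp.toLp_const_smul]
        congr 1
        ext ω
        simp [Finset.smul_sum, smul_comm c] }
    (∑ i, (eLpNorm (fun ω : EuclideanSpace ℝ ι => ω i) 2
      (stdGaussian (EuclideanSpace ℝ ι))).toReal) fun x => by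
    have hm (i : ι) : MemLp (fun ω : EuclideanSpace ℝ ι => ω i) 2
        (stdGaussian (EuclideanSpace ℝ ι)) :=
      IsGaussian.memLp_dual _ (EuclideanSpace.proj (𝕜 := ℝ) i) 2 (by norm_num)
    have h1 : eLpNorm (fun ω : EuclideanSpace ℝ ι => ∑ i, ω i • x i) 2
        (stdGaussian (EuclideanSpace ℝ ι)) ≤ ∑ i, eLpNorm (fun ω : EuclideanSpace ℝ ι => ω i) 2
          (stdGaussian (EuclideanSpace ℝ ι)) * ‖x‖ₑ := by
      have := eLpNorm_sum_le (f := fun (i : ι) (ω : EuclideanSpace ℝ ι) => ω i • x i)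
        (s := Finset.univ) (p := 2) (μ := stdGaussian (EuclideanSpace ℝ ι))
        (fun i _ => (by fun_prop)) (by norm_num)
      simp only [Finset.sum_fn] at this
      refine this.trans (Finset.sum_le_sum fun i _ => ?_)
      refine (eLpNorm_le_mul_eLpNorm_of_ae_le_mul (g := fun ω : EuclideanSpace ℝ ι => ω i)
        (c := ‖x‖) (ae_of_all _ fun ω => ?_) 2).trans ?_
      · rw [norm_smul, mul_comm]
        gcongr
        exact norm_le_pi_norm x i
      · rw [ofReal_norm, mul_comm]
    simp only [LinearMap.coe_mk, AddHom.coe_mk, Lp.norm_toLp]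
    rw [Finset.sum_mul]
    refine (ENNReal.toReal_mono ?_ h1).trans_eq ?_
    · exact ENNReal.sum_ne_top.2 fun i _ => ENNReal.mul_ne_top (hm i).2.ne (by simp)
    · rw [ENNReal.toReal_sum fun i _ => ENNReal.mul_ne_top (hm i).2.ne (by simp)]
      simp

lemma enorm_gaussSumLp (x : ι → X) : ‖gaussSumLp ι X x‖ₑ = gaussNorm x :=
  Lp.enorm_toLp (memLp_gaussSum x)

lemma gaussNorm_integral_le [CompleteSpace X] {α : Type*} [MeasurableSpace α] {μ : Measure α}
    {F : α → ι → X} (hF : Integrable F μ) :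
    gaussNorm (∫ a, F a ∂μ) ≤ ∫⁻ a, gaussNorm (F a) ∂μ := by
  rw [← enorm_gaussSumLp, ← ContinuousLinearMap.integral_comp_comm _ hF]
  simpa only [enorm_gaussSumLp] using
    enorm_integral_le_lintegral_enorm (fun a => gaussSumLp ι X (F a)) (μ := μ)

lemma continuous_gaussNorm : Continuous (gaussNorm : (ι → X) → ℝ≥0∞) := by
  have : (gaussNorm : (ι → X) → ℝ≥0∞) = fun x => ‖gaussSumLp ι X x‖ₑ :=
    funext fun x => (enorm_gaussSumLp x).symm
  rw [this]
  fun_prop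

lemma charFun_map_toEuclideanLin [DecidableEq κ] [DecidableEq ι] (M : Matrix ι κ ℝ)
    (t : EuclideanSpace ℝ ι) :
    charFun ((stdGaussian (EuclideanSpace ℝ κ)).map (Matrix.toEuclideanLin M)) t =
      Complex.exp (-(dotProduct t (Matrix.mulVec (M * M.transpose) t) : ℝ) / 2) := by
  have hc : Continuous (Matrix.toEuclideanLin M) := LinearMap.continuous_of_finiteDimensional _
  have hi (ω : EuclideanSpace ℝ κ) : inner ℝ (Matrix.toEuclideanLin M ω) t =
      inner ℝ ω (Matrix.toEuclideanLin M.transpose t) := by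
    have := Matrix.toEuclideanLin_conjTranspose_eq_adjoint M
    rw [Matrix.conjTranspose_eq_transpose_of_trivial] at this
    rw [this, LinearMap.adjoint_inner_right]
  rw [charFun_apply, integral_map hc.aemeasurable (by fun_prop)]
  simp_rw [hi]
  rw [← charFun_apply, charFun_stdGaussian, ← Complex.ofReal_pow, EuclideanSpace.real_norm_sq_eq]
  congr 4
  rw [← Matrix.mulVec_mulVec, Matrix.dotProduct_mulVec, ← Matrix.mulVec_transpose]
  simp [dotProduct, sq, Matrix.toLpLin_apply]

lemma stdGaussian_map_conv [DecidableEq κ] [DecidableEq ι] (M : Matrix ι κ ℝ)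
    (hM : (1 - M * M.transpose).PosSemidef) :
    ((stdGaussian (EuclideanSpace ℝ κ)).map (Matrix.toEuclideanLin M)).conv
      (multivariateGaussian 0 (1 - M * M.transpose)) = stdGaussian (EuclideanSpace ℝ ι) := by
  have hc : Continuous (Matrix.toEuclideanLin M) := LinearMap.continuous_of_finiteDimensional _
  have : IsProbabilityMeasure ((stdGaussian (EuclideanSpace ℝ κ)).map (Matrix.toEuclideanLin M)) :=
    Measure.isProbabilityMeasure_map hc.aemeasurable
  refine Measure.ext_of_charFun (E := EuclideanSpace ℝ ι) (funext fun t => ?_)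
  rw [charFun_conv, charFun_map_toEuclideanLin, charFun_multivariateGaussian hM,
    charFun_stdGaussian, ← Complex.exp_add, ← Complex.ofReal_pow, EuclideanSpace.real_norm_sq_eq]
  congr 1
  simp only [inner_zero_right, Matrix.sub_mulVec, dotProduct_sub, Matrix.one_mulVec]
  simp [dotProduct, sq]
  ring

/-- Gaussian sums are dominated under contractive real matrices. -/
lemma gaussNorm_matrix_le [CompleteSpace X] (A : κ → ι → ℝ)
    (hA : ∀ c : ι → ℝ, ∑ k, (∑ i, A k i * c i) ^ 2 ≤ ∑ i, c i ^ 2) (x : ι → X) :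
    gaussNorm (fun k => ∑ i, A k i • x i) ≤ gaussNorm x := by
  classical
  set M : Matrix ι κ ℝ := Matrix.of fun i k => A k i with hMdef
  have hM : (1 - M * M.transpose).PosSemidef := by
    refine Matrix.PosSemidef.of_dotProduct_mulVec_nonneg ?_ fun c => ?_
    · simp [Matrix.IsHermitian]
    · have := hA c
      simp only [star_trivial, Matrix.sub_mulVec, dotProduct_sub, Matrix.one_mulVec]
      rw [← Matrix.mulVec_mulVec, Matrix.dotProduct_mulVec, ← Matrix.mulVec_transpose, sub_nonneg]
      simpa [dotProduct, sq, Matrix.mulVec, hMdef] using this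
  have hc : Continuous (Matrix.toEuclideanLin M) := LinearMap.continuous_of_finiteDimensional _
  set T : EuclideanSpace ℝ ι →L[ℝ] X :=
    ∑ i, (EuclideanSpace.proj (𝕜 := ℝ) i : EuclideanSpace ℝ ι →L[ℝ] ℝ).smulRight (x i) with hT
  have hTa (ω : EuclideanSpace ℝ ι) : T ω = ∑ i, ω i • x i := by simp [hT]
  have key : gaussNorm (fun k => ∑ i, A k i • x i) ^ 2 ≤ gaussNorm x ^ 2 := by
    rw [gaussNorm_sq, gaussNorm_sq, ← stdGaussian_map_conv M hM,
      Measure.lintegral_conv (by fun_prop), lintegral_map (by fun_prop) hc.measurable]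
    refine lintegral_mono fun ω => ?_
    have h1 : ∑ k, ω k • ∑ i, A k i • x i = T (Matrix.toEuclideanLin M ω) := by
      rw [hTa]
      simp only [Matrix.toLpLin_apply, Matrix.mulVec, dotProduct, hMdef, Finset.sum_smul,
        Finset.smul_sum, Matrix.of_apply]
      rw [Finset.sum_comm]
      simp only [smul_smul, mul_comm]
    rw [h1]
    simp_rw [← hTa]
    set v := Matrix.toEuclideanLin M ω
    set ν := multivariateGaussian (0 : EuclideanSpace ℝ ι) (1 - M * M.transpose)
    have hint : Integrable (fun y : EuclideanSpace ℝ ι => y) ν := IsGaussian.integrable_fun_id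
    have h2 : T v = ∫ y, T (v + y) ∂ν := by
      simp_rw [map_add]
      rw [integral_add (integrable_const _) (T.integrable_comp hint),
        ContinuousLinearMap.integral_comp_comm _ hint]
      simp [ν]
    have h3 : ‖T v‖ₑ ≤ eLpNorm (fun y => T (v + y)) 2 ν := by
      rw [h2]
      refine (enorm_integral_le_lintegral_enorm _).trans ?_
      rw [← eLpNorm_one_eq_lintegral_enorm]
      exact eLpNorm_le_eLpNorm_of_exponent_le (by norm_num) (by fun_prop)
    rw [← eLpNorm_two_sq]
    gcongr
  exact (ENNReal.pow_right_strictMono (n := 2) (by norm_num)).le_iff_le.1 key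

end Gaussian

section Contraction

variable {ι κ X : Type*} [Fintype ι] [Fintype κ] [NormedAddCommGroup X]

lemma sum_sq_transpose_le {A : κ → ι → ℝ} {D : ℝ}
    (hA : ∀ c : ι → ℝ, ∑ k, (∑ i, A k i * c i) ^ 2 ≤ D ^ 2 * ∑ i, c i ^ 2) (d : κ → ℝ) :
    ∑ i, (∑ k, A k i * d k) ^ 2 ≤ D ^ 2 * ∑ k, d k ^ 2 := by
  set c : ι → ℝ := fun i => ∑ k, A k i * d k with hc
  have h1 : ∑ i, c i ^ 2 = ∑ k, d k * ∑ i, A k i * c i := by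
    simp only [Finset.mul_sum]
    rw [Finset.sum_comm]
    refine Finset.sum_congr rfl fun i _ => ?_
    rw [sq, hc, Finset.sum_mul]
    exact Finset.sum_congr rfl fun k _ => by ring
  have h2 := Finset.sum_mul_sq_le_sq_mul_sq Finset.univ d (fun k => ∑ i, A k i * c i)
  rw [← h1] at h2
  have h3 := h2.trans (mul_le_mul_of_nonneg_left (hA c) (Finset.sum_nonneg fun k _ => sq_nonneg _))
  have h4 : 0 ≤ ∑ i, c i ^ 2 := Finset.sum_nonneg fun k _ => sq_nonneg _
  rcases h4.eq_or_lt with h | h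
  · rw [← h]
    exact mul_nonneg (sq_nonneg _) (Finset.sum_nonneg fun k _ => sq_nonneg _)
  · nlinarith

lemma gaussNorm_matrix_le_mul [NormedSpace ℝ X] [CompleteSpace X] {A : κ → ι → ℝ} {D : ℝ}
    (hD : 0 < D) (hA : ∀ c : ι → ℝ, ∑ k, (∑ i, A k i * c i) ^ 2 ≤ D ^ 2 * ∑ i, c i ^ 2)
    (x : ι → X) :
    gaussNorm (fun k => ∑ i, A k i • x i) ≤ ENNReal.ofReal D * gaussNorm x := by
  have h1 := gaussNorm_matrix_le (fun k i => D⁻¹ * A k i) (fun c => by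
    have := hA c
    simp_rw [mul_assoc, ← Finset.mul_sum, mul_pow, ← Finset.mul_sum]
    rw [inv_pow, inv_mul_le_iff₀ (by positivity)]
    exact this) x
  have h2 : (fun k => ∑ i, A k i • x i) = D • (fun k => ∑ i, (D⁻¹ * A k i) • x i) := by
    ext k
    simp [Finset.smul_sum, smul_smul, hD.ne']
  rw [h2, gaussNorm_smul, Real.enorm_of_nonneg hD.le]
  gcongr

lemma gaussNorm_complex_matrix_le [NormedSpace ℂ X] [CompleteSpace X] {U : κ → ι → ℂ} {D : ℝ}
    (hD : 0 < D) (hU : ∀ c : ι → ℝ, ∑ k, ‖∑ i, c i * U k i‖ ^ 2 ≤ D ^ 2 * ∑ i, c i ^ 2) :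
    (∀ x : ι → X, gaussNorm (fun k => ∑ i, U k i • x i) ≤ ENNReal.ofReal (2 * D) * gaussNorm x) ∧
    (∀ x : κ → X, gaussNorm (fun i => ∑ k, U k i • x k) ≤
      ENNReal.ofReal (2 * D) * gaussNorm x) := by
  have hre (c : ι → ℝ) : ∑ k, (∑ i, (U k i).re * c i) ^ 2 ≤ D ^ 2 * ∑ i, c i ^ 2 := by
    refine le_trans (Finset.sum_le_sum fun k _ => ?_) (hU c)
    have h : ∑ i, (U k i).re * c i = (∑ i, c i * U k i).re := by simp [mul_comm]
    rw [h, ← sq_abs]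
    gcongr
    exact Complex.abs_re_le_norm _
  have him (c : ι → ℝ) : ∑ k, (∑ i, (U k i).im * c i) ^ 2 ≤ D ^ 2 * ∑ i, c i ^ 2 := by
    refine le_trans (Finset.sum_le_sum fun k _ => ?_) (hU c)
    have h : ∑ i, (U k i).im * c i = (∑ i, c i * U k i).im := by simp [mul_comm]
    rw [h, ← sq_abs]
    gcongr
    exact Complex.abs_im_le_norm _
  have hdec (z : ℂ) (v : X) : z • v = z.re • v + Complex.I • (z.im • v) := by
    conv_lhs => rw [← Complex.re_add_im z]
    rw [add_smul, mul_comm, mul_smul, Complex.coe_smul, Complex.coe_smul]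
  have h2D : ENNReal.ofReal (2 * D) = ENNReal.ofReal D + ENNReal.ofReal D := by
    rw [← ENNReal.ofReal_add hD.le hD.le, two_mul]
  rw [h2D]
  constructor <;> intro x
  · have : (fun k => ∑ i, U k i • x i) = (fun k => ∑ i, (U k i).re • x i) +
        Complex.I • (fun k => ∑ i, (U k i).im • x i) := by
      ext k
      simp only [Pi.add_apply, Pi.smul_apply, Finset.smul_sum, ← Finset.sum_add_distrib]
      exact Finset.sum_congr rfl fun i _ => hdec _ _
    rw [this, add_mul]
    refine (gaussNorm_add_le _ _).trans (add_le_add (gaussNorm_matrix_le_mul hD hre x) ?_)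
    rw [gaussNorm_smul]
    simpa [enorm_eq_nnnorm] using gaussNorm_matrix_le_mul hD him x
  · have : (fun i => ∑ k, U k i • x k) = (fun i => ∑ k, (U k i).re • x k) +
        Complex.I • (fun i => ∑ k, (U k i).im • x k) := by
      ext k
      simp only [Pi.add_apply, Pi.smul_apply, Finset.smul_sum, ← Finset.sum_add_distrib]
      exact Finset.sum_congr rfl fun i _ => hdec _ _
    rw [this, add_mul]
    refine (gaussNorm_add_le _ _).trans (add_le_add
      (gaussNorm_matrix_le_mul (A := fun i k => (U k i).re) hD (sum_sq_transpose_le hre) x) ?_)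
    rw [gaussNorm_smul]
    simpa [enorm_eq_nnnorm] using
      gaussNorm_matrix_le_mul (A := fun i k => (U k i).im) hD (sum_sq_transpose_le him) x

variable [NormedSpace ℝ X] [CompleteSpace X]

lemma gaussNorm_mul_le {a : ι → ℝ} (ha : ∀ i, |a i| ≤ 1) (x : ι → X) :
    gaussNorm (fun i => a i • x i) ≤ gaussNorm x := by
  classical
  have := gaussNorm_matrix_le (fun k i => if k = i then a k else 0) (fun c => ?_) x
  · simpa using this
  · refine Finset.sum_le_sum fun i _ => ?_
    simp only [ite_mul, zero_mul, Finset.sum_ite_eq, Finset.mem_univ, if_true, mul_pow]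
    exact mul_le_of_le_one_left (sq_nonneg _) ((sq_le_one_iff_abs_le_one _).2 (ha i))

lemma gaussNorm_sign {a : ι → ℝ} (ha : ∀ i, a i = 1 ∨ a i = -1) (x : ι → X) :
    gaussNorm (fun i => a i • x i) = gaussNorm x := by
  have h1 (i : ι) : |a i| ≤ 1 := by rcases ha i with h | h <;> simp [h]
  have h2 (i : ι) : a i * a i = 1 := by rcases ha i with h | h <;> simp [h]
  refine le_antisymm (gaussNorm_mul_le h1 x) ?_
  have := gaussNorm_mul_le h1 (fun i => a i • x i)
  simpa [smul_smul, h2] using this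

lemma gaussNorm_single [DecidableEq ι] (j : ι) (v : X) :
    gaussNorm (fun i => if i = j then v else 0) = ‖v‖ₑ := by
  refine le_antisymm ?_ ?_
  · have := gaussNorm_matrix_le (ι := Unit) (fun (k : ι) _ => if k = j then (1 : ℝ) else 0)
      (fun c => by simp) (fun _ => v)
    rw [gaussNorm_unique] at this
    simpa using this
  · have := gaussNorm_matrix_le (κ := Unit) (fun _ (i : ι) => if i = j then (1 : ℝ) else 0)
      (fun c => by
        simpa using Finset.single_le_sum (f := fun i => c i ^ 2) (fun i _ => sq_nonneg _)
          (Finset.mem_univ j)) (fun i => if i = j then v else 0)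
    rw [gaussNorm_unique] at this
    simpa using this

end Contraction

section Rademacher

variable {ι X : Type*} [Fintype ι] [NormedAddCommGroup X]

lemma radSign_eq_or (b : Bool) : radSign b = 1 ∨ radSign b = -1 := by
  cases b <;> simp [radSign]

lemma radAvg_nonneg {N : ℕ} {F : (Fin N → Bool) → ℝ} (hF : ∀ ε, 0 ≤ F ε) : 0 ≤ radAvg N F :=
  div_nonneg (Finset.sum_nonneg fun ε _ => hF ε) (by positivity)

lemma ofReal_radAvg_sq {N : ℕ} (v : (Fin N → Bool) → X) :
    ENNReal.ofReal (radAvg N fun ε => ‖v ε‖ ^ 2) = (∑ ε, ‖v ε‖ₑ ^ 2) / 2 ^ N := by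
  rw [radAvg, ENNReal.ofReal_div_of_pos (by positivity),
    ENNReal.ofReal_sum_of_nonneg (fun _ _ => by positivity)]
  congr 1
  · refine Finset.sum_congr rfl fun ε _ => ?_
    rw [ENNReal.ofReal_pow (norm_nonneg _), ofReal_norm]
  · rw [ENNReal.ofReal_pow (by norm_num)]
    norm_num

variable [NormedSpace ℝ X] [CompleteSpace X]

/-- Gaussian sums may be randomised blockwise by independent signs. -/
lemma gaussNorm_sq_eq_lintegral_radAvg {N : ℕ} (b : ι → Fin N) (x : ι → X) :
    gaussNorm x ^ 2 = ∫⁻ ω : EuclideanSpace ℝ ι, ENNReal.ofReal (radAvg N fun ε =>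
      ‖∑ j, radSign (ε j) • ∑ i, ω i • (if b i = j then x i else 0)‖ ^ 2)
        ∂(stdGaussian (EuclideanSpace ℝ ι)) := by
  simp_rw [ofReal_radAvg_sq]
  have h1 (ω : EuclideanSpace ℝ ι) (ε : Fin N → Bool) :
      ∑ j, radSign (ε j) • ∑ i, ω i • (if b i = j then x i else 0) =
        ∑ i, ω i • radSign (ε (b i)) • x i := by
    simp only [Finset.smul_sum]
    rw [Finset.sum_comm]
    refine Finset.sum_congr rfl fun i _ => ?_
    rw [Finset.sum_eq_single (b i) (fun j _ hj => by simp [hj.symm]) (by simp), if_pos rfl,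
      smul_comm]
  simp_rw [h1, div_eq_mul_inv]
  rw [lintegral_mul_const _ (by fun_prop), lintegral_finsetSum _ (fun ε _ => by fun_prop)]
  have h2 (ε : Fin N → Bool) : ∫⁻ ω : EuclideanSpace ℝ ι, ‖∑ i, ω i • radSign (ε (b i)) • x i‖ₑ ^ 2
      ∂(stdGaussian (EuclideanSpace ℝ ι)) = gaussNorm x ^ 2 := by
    rw [← gaussNorm_sq, gaussNorm_sign (fun i => radSign_eq_or _)]
  simp only [h2, Finset.sum_const, Finset.card_univ, Fintype.card_fun, Fintype.card_bool,
    Fintype.card_fin, nsmul_eq_mul]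
  rw [mul_comm, ← mul_assoc]
  push_cast
  rw [ENNReal.inv_mul_cancel (by simp) (by simp), one_mul]

end Rademacher

section TypeCotype

lemma ofReal_sum_norm_rpow {ι X : Type*} [Fintype ι] [NormedAddCommGroup X] (x : ι → X)
    {r s : ℝ} (hr : 0 ≤ r) (hs : 0 ≤ s) :
    ENNReal.ofReal ((∑ i, ‖x i‖ ^ r) ^ s) = (∑ i, ‖x i‖ₑ ^ r) ^ s := by
  rw [← ENNReal.ofReal_rpow_of_nonneg (Finset.sum_nonneg fun _ _ => by positivity) hs,
    ENNReal.ofReal_sum_of_nonneg (fun _ _ => by positivity)]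
  congr 1
  refine Finset.sum_congr rfl fun i _ => ?_
  rw [← ENNReal.ofReal_rpow_of_nonneg (norm_nonneg _) hr, ofReal_norm]

/-- Minkowski's inequality, exchanging a finite `ℓ^r` norm and an integral. -/
lemma rpow_sum_lintegral_le {α β : Type*} [MeasurableSpace α] [Fintype β] {μ : Measure α}
    {g : β → α → ℝ≥0∞} (hg : ∀ j, Measurable (g j)) (hfin : ∀ j, ∫⁻ a, g j a ∂μ ≠ ∞)
    {r : ℝ} (hr : 1 ≤ r) :
    (∑ j, (∫⁻ a, g j a ∂μ) ^ r) ^ (1 / r) ≤ ∫⁻ a, (∑ j, g j a ^ r) ^ (1 / r) ∂μ := by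
  rcases hr.eq_or_lt with rfl | hr
  · simp only [ENNReal.rpow_one, div_one]
    rw [lintegral_finsetSum _ fun j _ => hg j]
  set I : β → ℝ≥0∞ := fun j => ∫⁻ a, g j a ∂μ with hI
  set S := ∑ j, I j ^ r with hS
  have hr0 : 0 < r := by linarith
  have hSfin : S ≠ ∞ := ENNReal.sum_ne_top.2 fun j _ => ENNReal.rpow_ne_top_of_nonneg hr0.le (hfin j)
  rcases eq_or_ne S 0 with h0 | h0
  · rw [h0, ENNReal.zero_rpow_of_pos (by positivity)]
    exact zero_le
  set r' := r.conjExponent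
  have hc : r.HolderConjugate r' := Real.HolderConjugate.conjExponent hr
  have hc' : r'.HolderConjugate r := hc.symm
  have h1 : S = ∫⁻ a, ∑ j, I j ^ (r - 1) * g j a ∂μ := by
    rw [lintegral_finsetSum _ fun j _ => (hg j).const_mul _]
    refine Finset.sum_congr rfl fun j _ => ?_
    rw [lintegral_const_mul _ (hg j)]
    change I j ^ r = I j ^ (r - 1) * I j
    nth_rewrite 3 [← ENNReal.rpow_one (I j)]
    rw [← ENNReal.rpow_add_of_nonneg _ _ (by linarith) (by norm_num), sub_add_cancel]
  have h4 : S ^ (1 / r') ≠ 0 := by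
    simp [h0, hSfin]
  have h5 : S ^ (1 / r') ≠ ∞ := ENNReal.rpow_ne_top_of_nonneg (by have := hc'.pos; positivity) hSfin
  have h2 : S ≤ S ^ (1 / r') * ∫⁻ a, (∑ j, g j a ^ r) ^ (1 / r) ∂μ := by
    conv_lhs => rw [h1]
    rw [← lintegral_const_mul' _ _ h5]
    refine lintegral_mono fun a => ?_
    refine (ENNReal.inner_le_Lp_mul_Lq Finset.univ (fun j => I j ^ (r - 1)) (fun j => g j a) hc').trans_eq ?_
    simp only [← ENNReal.rpow_mul, hc.sub_one_mul_conj, hS]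
  have h3 : S = S ^ (1 / r') * S ^ (1 / r) := by
    rw [← ENNReal.rpow_add _ _ h0 hSfin, one_div, one_div, hc'.inv_add_inv_eq_one, ENNReal.rpow_one]
  rw [h3] at h2
  nth_rewrite 1 [← h3] at h2
  exact (ENNReal.mul_le_mul_iff_right h4 h5).1 (h3 ▸ h2)

lemma lintegral_rpow_sum_le {α β X : Type*} [MeasurableSpace α] [Fintype β] [NormedAddCommGroup X] {μ : Measure α}
    {Z : β → α → X} (hZ : ∀ j, AEStronglyMeasurable (Z j) μ) {p₀ : ℝ} (hp₀ : 0 < p₀)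
    (hp₀2 : p₀ ≤ 2) :
    ∫⁻ a, (∑ j, ‖Z j a‖ₑ ^ p₀) ^ (2 / p₀) ∂μ ≤ (∑ j, eLpNorm (Z j) 2 μ ^ p₀) ^ (2 / p₀) := by
  have h2 : 0 < 2 / p₀ := by positivity
  have hm (j : β) : AEStronglyMeasurable (fun a => ‖Z j a‖ ^ p₀) μ :=
    ((hZ j).norm.aemeasurable.pow_const p₀).aestronglyMeasurable
  have h1 := eLpNorm_sum_le (f := fun j a => ‖Z j a‖ ^ p₀) (s := Finset.univ)
    (p := ENNReal.ofReal (2 / p₀)) (μ := μ) (fun j _ => hm j)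
    (by rw [ENNReal.one_le_ofReal, le_div_iff₀ hp₀]; linarith)
  have h3 (j : β) : eLpNorm (fun a => ‖Z j a‖ ^ p₀) (ENNReal.ofReal (2 / p₀)) μ =
      eLpNorm (Z j) 2 μ ^ p₀ := by
    rw [eLpNorm_norm_rpow _ hp₀, ← ENNReal.ofReal_mul h2.le, div_mul_cancel₀ _ hp₀.ne']
    norm_num
  simp only [h3] at h1
  rw [eLpNorm_eq_lintegral_rpow_enorm_toReal (by simpa using h2) (by simp),
    ENNReal.toReal_ofReal h2.le] at h1
  have h4 := ENNReal.rpow_le_rpow h1 h2.le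
  rw [← ENNReal.rpow_mul, one_div, inv_mul_cancel₀ h2.ne', ENNReal.rpow_one] at h4
  refine le_trans (lintegral_mono fun a => le_of_eq ?_) h4
  congr 1
  rw [← ofReal_sum_norm_rpow (fun j => Z j a) hp₀.le zero_le_one |>.trans (ENNReal.rpow_one _)]
  simp only [Real.rpow_one, Finset.sum_apply]
  rw [Real.enorm_of_nonneg (Finset.sum_nonneg fun _ _ => by positivity)]

variable {ι β X Y : Type*} [Fintype ι] [Fintype β] [DecidableEq β] [NormedAddCommGroup X]
  [NormedSpace ℝ X] [CompleteSpace X] [NormedAddCommGroup Y] [NormedSpace ℝ Y] [CompleteSpace Y]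

lemma gaussNorm_le_of_type_fin {p₀ τ : ℝ} (hp₀ : 0 < p₀) (hp₀2 : p₀ ≤ 2) (hτ : 0 ≤ τ)
    (hType : ∀ (N : ℕ) (x : Fin N → X),
      Real.sqrt (radAvg N fun ε => ‖∑ i, radSign (ε i) • x i‖ ^ 2) ≤
        τ * (∑ i, ‖x i‖ ^ p₀) ^ (1 / p₀)) {N : ℕ} (b : ι → Fin N) (x : ι → X) :
    gaussNorm x ≤ ENNReal.ofReal τ *
      (∑ j, gaussNorm (fun i => if b i = j then x i else 0) ^ p₀) ^ (1 / p₀) := by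
  have h0 : gaussNorm x ^ 2 ≤ (ENNReal.ofReal τ *
      (∑ j, gaussNorm (fun i => if b i = j then x i else 0) ^ p₀) ^ (1 / p₀)) ^ 2 := by
    rw [gaussNorm_sq_eq_lintegral_radAvg b, mul_pow, ← ENNReal.rpow_natCast (_ ^ (1 / p₀)),
      ← ENNReal.rpow_mul]
    have h2 : (1 / p₀ * ((2 : ℕ) : ℝ)) = 2 / p₀ := by push_cast; ring
    rw [h2]
    set Z : Fin N → EuclideanSpace ℝ ι → X :=
      fun j ω => ∑ i, ω i • (if b i = j then x i else 0) with hZdef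
    refine le_trans (lintegral_mono (g := fun ω => ENNReal.ofReal τ ^ 2 *
      (∑ j, ‖Z j ω‖ₑ ^ p₀) ^ (2 / p₀)) fun ω => ?_) ?_
    · have h3 := hType N (fun j => Z j ω)
      have h4 : radAvg N (fun ε => ‖∑ j, radSign (ε j) • Z j ω‖ ^ 2) ≤
          τ ^ 2 * (∑ j, ‖Z j ω‖ ^ p₀) ^ (2 / p₀) := by
        have h5 := (Real.sqrt_le_left (by positivity)).1 h3
        rw [mul_pow, ← Real.rpow_natCast (_ ^ (1 / p₀)),
          ← Real.rpow_mul (Finset.sum_nonneg fun _ _ => by positivity), h2] at h5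
        exact h5
      refine (ENNReal.ofReal_le_ofReal h4).trans_eq ?_
      rw [ENNReal.ofReal_mul (by positivity), ofReal_sum_norm_rpow _ hp₀.le (by positivity),
        ENNReal.ofReal_pow hτ]
    · have hm (j : Fin N) : Continuous (Z j) := by fun_prop
      rw [lintegral_const_mul _ (Measurable.pow_const (Finset.measurable_fun_sum _
        fun j _ => (hm j).enorm.measurable.pow_const _) _)]
      gcongr
      exact lintegral_rpow_sum_le (fun j => (hm j).aestronglyMeasurable) hp₀ hp₀2
  exact (ENNReal.pow_right_strictMono (n := 2) (by norm_num)).le_iff_le.1 h0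

lemma gaussNorm_ge_of_cotype_fin {q₀ κ : ℝ} (hq₀ : 2 ≤ q₀) (hκ : 0 ≤ κ)
    (hCotype : ∀ (N : ℕ) (y : Fin N → Y),
      (∑ i, ‖y i‖ ^ q₀) ^ (1 / q₀) ≤
        κ * Real.sqrt (radAvg N fun ε => ‖∑ i, radSign (ε i) • y i‖ ^ 2))
    {N : ℕ} (b : ι → Fin N) (y : ι → Y) :
    (∑ j, gaussNorm (fun i => if b i = j then y i else 0) ^ q₀) ^ (1 / q₀) ≤
      ENNReal.ofReal κ * gaussNorm y := by
  have hq : 0 < q₀ := by linarith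
  have h2 : (1 / q₀ * ((2 : ℕ) : ℝ)) = 1 / (q₀ / 2) := by push_cast; field_simp
  have h0 : ((∑ j, gaussNorm (fun i => if b i = j then y i else 0) ^ q₀) ^ (1 / q₀)) ^ 2 ≤
      (ENNReal.ofReal κ * gaussNorm y) ^ 2 := by
    rw [mul_pow, gaussNorm_sq_eq_lintegral_radAvg b, ← ENNReal.rpow_natCast (_ ^ (1 / q₀)),
      ← ENNReal.rpow_mul, h2]
    set Z : Fin N → EuclideanSpace ℝ ι → Y :=
      fun j ω => ∑ i, ω i • (if b i = j then y i else 0) with hZdef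
    have hm (j : Fin N) : Continuous (Z j) := by fun_prop
    have h3 (j : Fin N) : gaussNorm (fun i => if b i = j then y i else 0) ^ q₀ =
        (∫⁻ ω, ‖Z j ω‖ₑ ^ 2 ∂(stdGaussian (EuclideanSpace ℝ ι))) ^ (q₀ / 2) := by
      rw [← gaussNorm_sq, ← ENNReal.rpow_natCast, ← ENNReal.rpow_mul]
      congr 1
      push_cast
      ring
    simp_rw [h3]
    refine (rpow_sum_lintegral_le (fun j => (hm j).enorm.measurable.pow_const _)
      (fun j => ?_) (by linarith)).trans ?_
    · rw [← gaussNorm_sq]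
      exact ENNReal.pow_ne_top (gaussNorm_ne_top _)
    · rw [← lintegral_const_mul' _ _ (ENNReal.pow_ne_top ENNReal.ofReal_ne_top)]
      refine lintegral_mono fun ω => ?_
      have h4 := hCotype N (fun j => Z j ω)
      have h5 := pow_le_pow_left₀ (by positivity) h4 2
      rw [mul_pow, Real.sq_sqrt (radAvg_nonneg fun _ => by positivity),
        ← Real.rpow_natCast (_ ^ (1 / q₀)),
        ← Real.rpow_mul (Finset.sum_nonneg fun _ _ => by positivity), h2] at h5
      have h6 := ENNReal.ofReal_le_ofReal h5
      rw [ofReal_sum_norm_rpow _ hq.le (by positivity), ENNReal.ofReal_mul (by positivity),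
        ENNReal.ofReal_pow hκ] at h6
      refine le_trans (le_of_eq ?_) h6
      congr 1
      refine Finset.sum_congr rfl fun j _ => ?_
      rw [← ENNReal.rpow_natCast, ← ENNReal.rpow_mul]
      congr 1
      push_cast
      ring
  exact (ENNReal.pow_right_strictMono (n := 2) (by norm_num)).le_iff_le.1 h0

/-- Type `p₀` estimate for Gaussian sums split into blocks. -/
lemma gaussNorm_le_of_type {p₀ τ : ℝ} (hp₀ : 0 < p₀) (hp₀2 : p₀ ≤ 2) (hτ : 0 ≤ τ)
    (hType : ∀ (N : ℕ) (x : Fin N → X),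
      Real.sqrt (radAvg N fun ε => ‖∑ i, radSign (ε i) • x i‖ ^ 2) ≤
        τ * (∑ i, ‖x i‖ ^ p₀) ^ (1 / p₀)) (b : ι → β) (x : ι → X) :
    gaussNorm x ≤ ENNReal.ofReal τ *
      (∑ j, gaussNorm (fun i => if b i = j then x i else 0) ^ p₀) ^ (1 / p₀) := by
  have h := gaussNorm_le_of_type_fin hp₀ hp₀2 hτ hType (fun i => Fintype.equivFin β (b i)) x
  rw [← (Fintype.equivFin β).sum_comp] at h
  simpa only [EmbeddingLike.apply_eq_iff_eq] using h

/-- Cotype `q₀` estimate for Gaussian sums split into blocks. -/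
lemma gaussNorm_ge_of_cotype {q₀ κ : ℝ} (hq₀ : 2 ≤ q₀) (hκ : 0 ≤ κ)
    (hCotype : ∀ (N : ℕ) (y : Fin N → Y),
      (∑ i, ‖y i‖ ^ q₀) ^ (1 / q₀) ≤
        κ * Real.sqrt (radAvg N fun ε => ‖∑ i, radSign (ε i) • y i‖ ^ 2))
    (b : ι → β) (y : ι → Y) :
    (∑ j, gaussNorm (fun i => if b i = j then y i else 0) ^ q₀) ^ (1 / q₀) ≤
      ENNReal.ofReal κ * gaussNorm y := by
  have h := gaussNorm_ge_of_cotype_fin hq₀ hκ hCotype (fun i => Fintype.equivFin β (b i)) y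
  rw [← (Fintype.equivFin β).sum_comp] at h
  simpa only [EmbeddingLike.apply_eq_iff_eq] using h

lemma sum_smul_ite_equiv {ι E : Type*} [Fintype ι] [NormedAddCommGroup E] [NormedSpace ℝ E] {N : ℕ}
    (e : ι ≃ Fin N) (z : ι → E) (ω : EuclideanSpace ℝ ι) (j : Fin N) :
    ∑ i, ω i • (if e i = j then z i else 0) = ω (e.symm j) • z (e.symm j) := by
  rw [Finset.sum_eq_single (e.symm j)]
  · simp
  · intro i _ hi
    rw [if_neg fun h => hi (by simp [← h]), smul_zero]
  · simp

/-- An `R`-bounded diagonal operator is bounded on Gaussian sums. -/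
lemma gaussNorm_le_of_rBounded {ρ : ℝ} (hρ : 0 ≤ ρ) {N : ℕ} {T : Fin N → X → Y}
    (hT : ∀ j (c : ℝ) v, T j (c • v) = c • T j v)
    (hR : ∀ x : Fin N → X,
      Real.sqrt (radAvg N fun ε => ‖∑ i, radSign (ε i) • T i (x i)‖ ^ 2) ≤
        ρ * Real.sqrt (radAvg N fun ε => ‖∑ i, radSign (ε i) • x i‖ ^ 2))
    (e : ι ≃ Fin N) (x : ι → X) :
    gaussNorm (fun i => T (e i) (x i)) ≤ ENNReal.ofReal ρ * gaussNorm x := by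
  have h0 : gaussNorm (fun i => T (e i) (x i)) ^ 2 ≤ (ENNReal.ofReal ρ * gaussNorm x) ^ 2 := by
    rw [mul_pow, gaussNorm_sq_eq_lintegral_radAvg e, gaussNorm_sq_eq_lintegral_radAvg e,
      ← lintegral_const_mul' _ _ (ENNReal.pow_ne_top ENNReal.ofReal_ne_top)]
    refine lintegral_mono fun ω => ?_
    simp only [sum_smul_ite_equiv, Equiv.apply_symm_apply, ← hT]
    have h1 := pow_le_pow_left₀ (Real.sqrt_nonneg _)
      (hR (fun j => ω (e.symm j) • x (e.symm j))) 2
    rw [mul_pow, Real.sq_sqrt (radAvg_nonneg fun _ => by positivity),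
      Real.sq_sqrt (radAvg_nonneg fun _ => by positivity)] at h1
    simp only [← hT] at h1
    rw [← ENNReal.ofReal_pow hρ, ← ENNReal.ofReal_mul (by positivity)]
    exact ENNReal.ofReal_le_ofReal h1
  exact (ENNReal.pow_right_strictMono (n := 2) (by norm_num)).le_iff_le.1 h0

end TypeCotype

section CellKernel

variable {n : ℕ}

/-- The Fourier transform of the `L²`-normalised indicator of `E`. -/
noncomputable def cellKernel (E : Set (EuclideanSpace ℝ (Fin n))) (x : EuclideanSpace ℝ (Fin n)) : ℂ :=
  ((√(volume.real E))⁻¹ : ℝ) * ∫ ξ in E, (Real.fourierChar (-(inner ℝ ξ x)) : ℂ)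

/-- The cube of side `1 / δ` centred at the origin. -/
def freqCube (n : ℕ) (δ : ℝ) : Set (EuclideanSpace ℝ (Fin n)) :=
  {ξ | ∀ l, ξ l ∈ Set.Ioc (-(1 / (2 * δ))) (1 / (2 * δ))}

lemma measurableSet_freqCube (δ : ℝ) : MeasurableSet (freqCube n δ) := by
  have : freqCube n δ = ⋂ l, (fun ξ : EuclideanSpace ℝ (Fin n) => ξ l) ⁻¹'
      Set.Ioc (-(1 / (2 * δ))) (1 / (2 * δ)) := by
    ext; simp [freqCube]
  rw [this]
  exact MeasurableSet.iInter fun l => (by fun_prop : Measurable fun ξ : EuclideanSpace ℝ (Fin n) => ξ l)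
    measurableSet_Ioc

lemma integral_fourierChar_Ioc {δ : ℝ} (hδ : 0 < δ) (j : ℤ) :
    ∫ t in Set.Ioc (-(1 / (2 * δ))) (1 / (2 * δ)), (Real.fourierChar (-(t * (δ * j))) : ℂ) =
      if j = 0 then ((1 / δ : ℝ) : ℂ) else 0 := by
  have hle : -(1 / (2 * δ)) ≤ 1 / (2 * δ) := by
    have : 0 ≤ 1 / (2 * δ) := by positivity
    linarith
  rw [← intervalIntegral.integral_of_le hle]
  split_ifs with h
  · subst h
    simp
    field_simp
    norm_num
  · set c : ℂ := -(2 * Real.pi * Complex.I * δ * j) with hc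
    have hc0 : c ≠ 0 := by
      simp [hc, Real.pi_ne_zero, hδ.ne', h]
    have h1 (t : ℝ) : (Real.fourierChar (-(t * (δ * j))) : ℂ) = Complex.exp (c * t) := by
      rw [Real.fourierChar_apply]
      congr 1
      push_cast
      rw [hc]
      ring
    simp_rw [h1]
    rw [integral_exp_mul_complex hc0]
    have h2 : Complex.exp (c * ((1 / (2 * δ) : ℝ) : ℂ)) =
        Complex.exp (c * ((-(1 / (2 * δ)) : ℝ) : ℂ)) := by
      rw [Complex.exp_eq_exp_iff_exists_int]
      refine ⟨-j, ?_⟩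
      have : (δ : ℂ) ≠ 0 := by exact_mod_cast hδ.ne'
      rw [hc]
      push_cast
      field_simp
      ring
    rw [h2, sub_self, zero_div]

lemma integral_fourierChar_freqCube {δ : ℝ} (hδ : 0 < δ) (j : Fin n → ℤ) :
    ∫ ξ in freqCube n δ, (Real.fourierChar (-(∑ l, ξ l * (δ * j l))) : ℂ) =
      if j = 0 then (((1 / δ) ^ n : ℝ) : ℂ) else 0 := by
  rw [← integral_indicator (measurableSet_freqCube δ)]
  set g : Fin n → ℝ → ℂ := fun l => (Set.Ioc (-(1 / (2 * δ))) (1 / (2 * δ))).indicator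
    fun t => (Real.fourierChar (-(t * (δ * j l))) : ℂ) with hg
  have h1 (ξ : EuclideanSpace ℝ (Fin n)) : (freqCube n δ).indicator
      (fun ξ => (Real.fourierChar (-(∑ l, ξ l * (δ * j l))) : ℂ)) ξ =
        ∏ l, g l (ξ l) := by
    by_cases h : ξ ∈ freqCube n δ
    · rw [Set.indicator_of_mem h, ← Finset.sum_neg_distrib]
      have : ∀ l, g l (ξ l) = (Real.fourierChar (-(ξ l * (δ * j l))) : ℂ) := fun l => by
        rw [hg]
        exact Set.indicator_of_mem (h l) _
      simp_rw [this, Real.fourierChar_apply, ← Complex.exp_sum]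
      congr 1
      push_cast
      rw [Finset.mul_sum, Finset.sum_mul]
    · rw [Set.indicator_of_notMem h]
      simp only [freqCube, Set.mem_ofPred_eq, not_forall] at h
      obtain ⟨l, hl⟩ := h
      exact (Finset.prod_eq_zero (Finset.mem_univ l) (Set.indicator_of_notMem hl _)).symm
  simp_rw [h1]
  have h2 := (EuclideanSpace.volume_preserving_symm_measurableEquiv_toLp (Fin n)).symm.integral_comp'
    (g := fun ξ : EuclideanSpace ℝ (Fin n) => ∏ l, g l (ξ l))
  rw [← h2]
  have h3 := integral_fintype_prod_volume_eq_prod g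
  refine Eq.trans ?_ (h3.trans ?_)
  · rfl
  · simp_rw [hg, integral_indicator measurableSet_Ioc, integral_fourierChar_Ioc hδ]
    split_ifs with h
    · simp [h]
    · obtain ⟨l, hl⟩ := Function.ne_iff.1 h
      exact Finset.prod_eq_zero (Finset.mem_univ l) (if_neg hl)

lemma volume_freqCube_ne_top (δ : ℝ) : volume (freqCube n δ) ≠ ∞ := by
  refine ((Metric.isBounded_closedBall (x := (0 : EuclideanSpace ℝ (Fin n)))
    (r := √(∑ _l : Fin n, (1 / (2 * δ)) ^ 2))).subset fun ξ hξ => ?_).measure_lt_top.ne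
  rw [mem_closedBall_zero_iff, EuclideanSpace.norm_eq]
  refine Real.sqrt_le_sqrt (Finset.sum_le_sum fun l _ => ?_)
  rw [Real.norm_eq_abs]
  exact pow_le_pow_left₀ (abs_nonneg _) (abs_le.2 ⟨(hξ l).1.le, (hξ l).2⟩) 2

/-- Orthogonality of the exponentials attached to the points of a lattice. -/
lemma integral_sq_sum_fourierChar {κ : Type*} [Fintype κ] {δ : ℝ} (hδ : 0 < δ)
    (a : EuclideanSpace ℝ (Fin n)) {j : κ → Fin n → ℤ} (hj : Function.Injective j)
    {x : κ → EuclideanSpace ℝ (Fin n)} (hx : ∀ k l, x k l = a l + δ * j k l) (c : κ → ℝ) :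
    ∫ ξ in freqCube n δ, ‖∑ k, c k * (Real.fourierChar (-(inner ℝ ξ (x k))) : ℂ)‖ ^ 2 =
      (1 / δ) ^ n * ∑ k, c k ^ 2 := by
  classical
  have h1 (ξ : EuclideanSpace ℝ (Fin n)) :
      ((‖∑ k, c k * (Real.fourierChar (-(inner ℝ ξ (x k))) : ℂ)‖ ^ 2 : ℝ) : ℂ) =
      ∑ k, ∑ k', ((c k * c k' : ℝ) : ℂ) *
        (Real.fourierChar (-(∑ l, ξ l * (δ * (j k - j k') l : ))) : ℂ) := by
    rw [← Complex.normSq_eq_norm_sq, Complex.normSq_eq_conj_mul_self, mul_comm, map_sum,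
      Finset.sum_mul_sum]
    refine Finset.sum_congr rfl fun k _ => Finset.sum_congr rfl fun k' _ => ?_
    rw [map_mul, Complex.conj_ofReal, ← Circle.coe_inv_eq_conj, ← AddChar.map_neg_eq_inv,
      mul_mul_mul_comm, ← Circle.coe_mul, ← AddChar.map_add_eq_mul, ← Complex.ofReal_mul]
    congr 3
    simp only [PiLp.inner_apply, hx, Pi.sub_apply, neg_neg, ← Finset.sum_neg_distrib,
      ← Finset.sum_add_distrib]
    refine Finset.sum_congr rfl fun l _ => ?_
    simp
    ring
  have h2 : ((∫ ξ in freqCube n δ,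
      ‖∑ k, c k * (Real.fourierChar (-(inner ℝ ξ (x k))) : ℂ)‖ ^ 2 : ℝ) : ℂ) =
      (((1 / δ) ^ n * ∑ k, c k ^ 2 : ℝ) : ℂ) := by
    rw [← integral_complex_ofReal]
    simp_rw [h1]
    have hi (k k' : κ) : IntegrableOn (fun ξ : EuclideanSpace ℝ (Fin n) =>
        ((c k * c k' : ℝ) : ℂ) * (Real.fourierChar (-(∑ l, ξ l * (δ * (j k - j k') l : ))) : ℂ))
        (freqCube n δ) := by
      refine Measure.integrableOn_of_bounded (M := ‖((c k * c k' : ℝ) : ℂ)‖)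
        (volume_freqCube_ne_top δ) ?_ ?_
      · refine Continuous.aestronglyMeasurable ?_
        fun_prop
      · refine Filter.Eventually.of_forall fun ξ => ?_
        rw [norm_mul, Circle.norm_coe, mul_one]
    rw [integral_finsetSum _ fun k _ => integrable_finsetSum _ fun k' _ => hi k k']
    simp_rw [integral_finsetSum _ fun k' _ => hi _ k', integral_const_mul,
      integral_fourierChar_freqCube hδ, sub_eq_zero, hj.eq_iff, mul_ite, mul_zero]
    simp only [Finset.sum_ite_eq, Finset.mem_univ, if_true]
    push_cast
    rw [Finset.mul_sum]
    refine Finset.sum_congr rfl fun k _ => ?_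
    ring
  exact_mod_cast h2

lemma enorm_integral_sq_le {α E : Type*} [MeasurableSpace α] [NormedAddCommGroup E]
    [NormedSpace ℝ E] {μ : Measure α} {f : α → E} (hf : AEStronglyMeasurable f μ) :
    ‖∫ a, f a ∂μ‖ₑ ^ 2 ≤ μ Set.univ * ∫⁻ a, ‖f a‖ₑ ^ 2 ∂μ := by
  have h1 : ‖∫ a, f a ∂μ‖ₑ ≤ eLpNorm f 2 μ * μ Set.univ ^ (1 / 2 : ℝ) := by
    refine (enorm_integral_le_lintegral_enorm f).trans ?_
    rw [← eLpNorm_one_eq_lintegral_enorm]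
    refine (eLpNorm_le_eLpNorm_mul_rpow_measure_univ (by norm_num : (1 : ℝ≥0∞) ≤ 2) hf).trans_eq ?_
    norm_num
  refine (pow_le_pow_left' h1 2).trans_eq ?_
  rw [mul_pow, eLpNorm_two_sq, mul_comm, ← ENNReal.rpow_natCast, ← ENNReal.rpow_mul]
  norm_num

lemma sum_sq_cellKernel_le {ι κ : Type*} [Fintype ι] [Fintype κ] {δ : ℝ} (hδ : 0 < δ)
    (a : EuclideanSpace ℝ (Fin n)) {j : κ → Fin n → ℤ} (hj : Function.Injective j)
    {x : κ → EuclideanSpace ℝ (Fin n)} (hx : ∀ k l, x k l = a l + δ * j k l)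
    {E : ι → Set (EuclideanSpace ℝ (Fin n))} (hE : ∀ i, MeasurableSet (E i))
    (hd : Pairwise (Function.onFun Disjoint E)) (hEδ : ∀ i, E i ⊆ freqCube n δ) (c : κ → ℝ) :
    ∑ i, ‖∑ k, c k * cellKernel (E i) (x k)‖ ^ 2 ≤ (1 / δ) ^ n * ∑ k, c k ^ 2 := by
  set F : EuclideanSpace ℝ (Fin n) → ℂ :=
    fun ξ => ∑ k, c k * (Real.fourierChar (-(inner ℝ ξ (x k))) : ℂ) with hF
  have hFc : Continuous F := by fun_prop
  have hEtop (i : ι) : volume (E i) ≠ ∞ :=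
    measure_ne_top_of_subset (hEδ i) (volume_freqCube_ne_top δ)
  have h1 (i : ι) : ∑ k, c k * cellKernel (E i) (x k) =
      ((√(volume.real (E i)))⁻¹ : ℝ) * ∫ ξ in E i, F ξ := by
    rw [hF, integral_finsetSum, Finset.mul_sum]
    · refine Finset.sum_congr rfl fun k _ => ?_
      rw [integral_const_mul, cellKernel]
      ring
    · intro k _
      refine Measure.integrableOn_of_bounded (M := ‖((c k : ℝ) : ℂ)‖) (hEtop i)
        (by fun_prop) (Filter.Eventually.of_forall fun ξ => ?_)
      rw [norm_mul, Circle.norm_coe, mul_one]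
  have h2 (i : ι) : ‖∑ k, c k * cellKernel (E i) (x k)‖ₑ ^ 2 ≤ ∫⁻ ξ in E i, ‖F ξ‖ₑ ^ 2 := by
    rw [h1, enorm_mul, mul_pow]
    refine (mul_le_mul_right (enorm_integral_sq_le hFc.aestronglyMeasurable) _).trans ?_
    rw [← mul_assoc, Measure.restrict_apply_univ]
    refine mul_le_of_le_one_left zero_le ?_
    rw [← ofReal_norm, Complex.norm_real, Real.norm_of_nonneg (by positivity),
      ← ENNReal.ofReal_pow (by positivity), inv_pow, Real.sq_sqrt (by positivity),
      ← ofReal_measureReal (hEtop i), ← ENNReal.ofReal_mul (by positivity)]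
    exact ENNReal.ofReal_le_one.2 inv_mul_le_one
  have h3 : ∑ i, ‖∑ k, c k * cellKernel (E i) (x k)‖ₑ ^ 2 ≤
      ∫⁻ ξ in freqCube n δ, ‖F ξ‖ₑ ^ 2 := by
    refine (Finset.sum_le_sum fun i _ => h2 i).trans ?_
    rw [← tsum_fintype (L := SummationFilter.unconditional ι), ← lintegral_iUnion hE hd]
    exact lintegral_mono_set (Set.iUnion_subset hEδ)
  have hint : IntegrableOn (fun ξ => ‖F ξ‖ ^ 2) (freqCube n δ) := by
    refine Measure.integrableOn_of_bounded (M := (∑ k, |c k|) ^ 2) (volume_freqCube_ne_top δ)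
      (by fun_prop) (Filter.Eventually.of_forall fun ξ => ?_)
    rw [norm_pow, norm_norm]
    refine pow_le_pow_left₀ (norm_nonneg _) ((norm_sum_le _ _).trans_eq ?_) 2
    refine Finset.sum_congr rfl fun k _ => ?_
    rw [norm_mul, Circle.norm_coe, mul_one, Complex.norm_real, Real.norm_eq_abs]
  have h4 : ∫⁻ ξ in freqCube n δ, ‖F ξ‖ₑ ^ 2 = ENNReal.ofReal ((1 / δ) ^ n * ∑ k, c k ^ 2) := by
    rw [← integral_sq_sum_fourierChar hδ a hj hx c,
      ofReal_integral_eq_lintegral_ofReal hint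
        (Filter.Eventually.of_forall fun ξ => by positivity)]
    refine lintegral_congr fun ξ => ?_
    rw [ENNReal.ofReal_pow (norm_nonneg _), ofReal_norm]
  rw [h4] at h3
  refine (ENNReal.ofReal_le_ofReal_iff (by positivity)).1 (le_trans (le_of_eq ?_) h3)
  rw [ENNReal.ofReal_sum_of_nonneg fun _ _ => by positivity]
  refine Finset.sum_congr rfl fun i _ => ?_
  rw [ENNReal.ofReal_pow (norm_nonneg _), ofReal_norm]

end CellKernel

section Tiling

variable {n : ℕ}

/-- The half-open cubes of side `δ` tiling `ℝⁿ`. -/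
def tile (δ : ℝ) (j : Fin n → ℤ) : Set (EuclideanSpace ℝ (Fin n)) :=
  {x | ∀ l, ⌊x l / δ⌋ = j l}

/-- The lattice point `δ j`. -/
noncomputable def latticePt (δ : ℝ) (j : Fin n → ℤ) : EuclideanSpace ℝ (Fin n) :=
  WithLp.toLp 2 fun l => δ * j l

lemma measurableSet_tile (δ : ℝ) (j : Fin n → ℤ) : MeasurableSet (tile δ j) := by
  have : tile δ j = ⋂ l, (fun ξ : EuclideanSpace ℝ (Fin n) => ⌊ξ l / δ⌋) ⁻¹' {j l} := by
    ext; simp [tile]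
  rw [this]
  exact MeasurableSet.iInter fun l =>
    (by fun_prop : Measurable fun ξ : EuclideanSpace ℝ (Fin n) => ⌊ξ l / δ⌋)
    (measurableSet_singleton _)

lemma pairwise_disjoint_tile (δ : ℝ) : Pairwise (Function.onFun Disjoint (tile (n := n) δ)) := by
  intro j j' h
  refine Set.disjoint_left.2 fun x hx hx' => h (funext fun l => ?_)
  rw [← hx l, ← hx' l]

lemma iUnion_tile (δ : ℝ) : ⋃ j, tile (n := n) δ j = Set.univ :=
  Set.eq_univ_of_forall fun x => Set.mem_iUnion.2 ⟨fun l => ⌊x l / δ⌋, fun _ => rfl⟩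

lemma preimage_add_latticePt {δ : ℝ} (hδ : 0 < δ) (j : Fin n → ℤ) :
    (fun z => z + latticePt δ j) ⁻¹' tile δ j = tile δ 0 := by
  ext z
  simp only [tile, latticePt, Set.mem_preimage, Set.mem_ofPred_eq, PiLp.add_apply, Pi.zero_apply]
  refine forall_congr' fun l => ?_
  rw [add_div, mul_div_cancel_left₀ _ hδ.ne', Int.floor_add_intCast]
  omega

lemma volume_tile_zero {δ : ℝ} (hδ : 0 < δ) :
    volume (tile (n := n) δ 0) = ENNReal.ofReal δ ^ n := by
  have h := (EuclideanSpace.volume_preserving_symm_measurableEquiv_toLp (Fin n)).measure_preimage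
    (s := Set.univ.pi fun _ => Set.Ico 0 δ)
    (MeasurableSet.univ_pi fun _ => measurableSet_Ico).nullMeasurableSet
  rw [Real.volume_pi_Ico] at h
  simp only [sub_zero, Finset.prod_const, Finset.card_univ, Fintype.card_fin] at h
  rw [← h]
  congr 1
  ext z
  simp only [tile, Set.mem_ofPred_eq, Pi.zero_apply, Set.mem_preimage, Set.mem_pi, Set.mem_univ,
    true_imp_iff, Int.floor_eq_zero_iff, Set.mem_Ico]
  refine forall_congr' fun l => ?_
  rw [div_lt_one hδ, le_div_iff₀ hδ, zero_mul]
  rfl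

lemma lintegral_eq_lintegral_tile {δ : ℝ} (hδ : 0 < δ) {g : EuclideanSpace ℝ (Fin n) → ℝ≥0∞}
    (hg : AEMeasurable g) :
    ∫⁻ x, g x = ∫⁻ z in tile δ 0, ∑' j, g (z + latticePt δ j) := by
  rw [← setLIntegral_univ, ← iUnion_tile (n := n) δ,
    lintegral_iUnion (measurableSet_tile δ) (pairwise_disjoint_tile δ), lintegral_tsum]
  · refine tsum_congr fun j => ?_
    rw [← preimage_add_latticePt hδ j]
    exact ((measurePreserving_add_right volume (latticePt δ j)).setLIntegral_comp_preimage_emb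
      (MeasurableEquiv.addRight (latticePt δ j)).measurableEmbedding g _).symm
  · intro j
    exact (hg.comp_quasiMeasurePreserving
      (measurePreserving_add_right volume (latticePt δ j)).quasiMeasurePreserving).restrict

lemma hasSum_integral_tile {δ : ℝ} (hδ : 0 < δ) {W : Type*} [NormedAddCommGroup W]
    [NormedSpace ℝ W] {g : EuclideanSpace ℝ (Fin n) → W} (hg : Integrable g) :
    HasSum (fun j => ∫ z in tile δ 0, g (z + latticePt δ j)) (∫ x, g x) := by
  have h := hasSum_integral_iUnion (measurableSet_tile δ) (pairwise_disjoint_tile δ)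
    (hg.integrableOn (s := ⋃ j, tile (n := n) δ j))
  rw [iUnion_tile, setIntegral_univ] at h
  convert h using 2 with j
  rw [← preimage_add_latticePt hδ j]
  exact (measurePreserving_add_right volume (latticePt δ j)).setIntegral_preimage_emb
      (MeasurableEquiv.addRight (latticePt δ j)).measurableEmbedding g _

end Tiling

section KernelBounds

variable {n : ℕ} {ι X : Type*} [Fintype ι] [NormedAddCommGroup X] [NormedSpace ℂ X] [CompleteSpace X]

lemma gaussNorm_cellKernel_le {κ : Type*} [Fintype κ] {δ : ℝ} (hδ : 0 < δ)
    (a : EuclideanSpace ℝ (Fin n)) {j : κ → Fin n → ℤ} (hj : Function.Injective j)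
    {E : ι → Set (EuclideanSpace ℝ (Fin n))} (hE : ∀ i, MeasurableSet (E i))
    (hd : Pairwise (Function.onFun Disjoint E)) (hEδ : ∀ i, E i ⊆ freqCube n δ) :
    (∀ v : κ → X, gaussNorm (fun i => ∑ k, cellKernel (E i) (a + latticePt δ (j k)) • v k) ≤
      ENNReal.ofReal (2 * δ ^ (-(n / 2 : ℝ))) * gaussNorm v) ∧
    (∀ y : ι → X, gaussNorm (fun k => ∑ i, cellKernel (E i) (a + latticePt δ (j k)) • y i) ≤
      ENNReal.ofReal (2 * δ ^ (-(n / 2 : ℝ))) * gaussNorm y) := by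
  refine gaussNorm_complex_matrix_le (U := fun i k => cellKernel (E i) (a + latticePt δ (j k)))
    (by positivity) fun c => ?_
  have h : (δ ^ (-(n / 2 : ℝ))) ^ 2 = (1 / δ) ^ n := by
    rw [← Real.rpow_natCast, ← Real.rpow_mul hδ.le, one_div, ← Real.rpow_natCast,
      Real.inv_rpow hδ.le, ← Real.rpow_neg hδ.le]
    congr 1
    push_cast
    ring
  rw [h]
  exact sum_sq_cellKernel_le hδ a hj (fun k l => by simp [latticePt]) hE hd hEδ c

lemma enorm_sum_cellKernel_le {δ : ℝ} (hδ : 0 < δ) (x : EuclideanSpace ℝ (Fin n))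
    {E : ι → Set (EuclideanSpace ℝ (Fin n))} (hE : ∀ i, MeasurableSet (E i))
    (hd : Pairwise (Function.onFun Disjoint E)) (hEδ : ∀ i, E i ⊆ freqCube n δ) (y : ι → X) :
    ‖∑ i, cellKernel (E i) x • y i‖ₑ ≤ ENNReal.ofReal (2 * δ ^ (-(n / 2 : ℝ))) * gaussNorm y := by
  have h := (gaussNorm_cellKernel_le (κ := Unit) hδ x (j := fun _ => 0)
    (fun _ _ _ => rfl) hE hd hEδ).2 y
  rw [gaussNorm_unique] at h
  simpa [latticePt, ← Pi.zero_def] using h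

lemma continuous_cellKernel (E : Set (EuclideanSpace ℝ (Fin n))) (hE : volume E ≠ ∞) :
    Continuous (cellKernel E) := by
  unfold cellKernel
  refine continuous_const.mul ?_
  refine continuous_of_dominated (bound := fun _ => (1 : ℝ)) (fun x => by fun_prop)
    (fun x => Filter.Eventually.of_forall fun ξ => by rw [Circle.norm_coe]) ?_
    (Filter.Eventually.of_forall fun ξ => by fun_prop)
  exact integrableOn_const (by simpa using hE)

lemma norm_cellKernel_le (E : Set (EuclideanSpace ℝ (Fin n))) (x : EuclideanSpace ℝ (Fin n)) :
    ‖cellKernel E x‖ ≤ (√(volume.real E))⁻¹ * volume.real E := by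
  rw [cellKernel, norm_mul, Complex.norm_real, Real.norm_of_nonneg (by positivity)]
  refine mul_le_mul_of_nonneg_left ?_ (by positivity)
  have := norm_integral_le_integral_norm (μ := volume.restrict E)
    (fun ξ : EuclideanSpace ℝ (Fin n) => (Real.fourierChar (-(inner ℝ ξ x)) : ℂ))
  simpa only [Circle.norm_coe, integral_const, smul_eq_mul, mul_one, measureReal_restrict_apply_univ]
    using this

/-- `L^r` bound for the coefficients of a function against the cell kernels. -/
lemma gaussNorm_integral_cellKernel_le {δ : ℝ} (hδ : 0 < δ)
    {E : ι → Set (EuclideanSpace ℝ (Fin n))} (hE : ∀ i, MeasurableSet (E i))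
    (hd : Pairwise (Function.onFun Disjoint E)) (hEδ : ∀ i, E i ⊆ freqCube n δ)
    {r : ℝ} (hr : 1 ≤ r) {τ : ℝ≥0∞}
    (hτ' : τ ≠ ∞) (hτ : ∀ (J : Finset (Fin n → ℤ)) (v : J → X),
      gaussNorm v ≤ τ * (∑ j, ‖v j‖ₑ ^ r) ^ (1 / r))
    {g : EuclideanSpace ℝ (Fin n) → X} (hg : Integrable g) :
    gaussNorm (fun i => ∫ x, cellKernel (E i) x • g x) ≤
      ENNReal.ofReal (2 * δ ^ (n * (1 / 2 - 1 / r))) * τ * (∫⁻ x, ‖g x‖ₑ ^ r) ^ (1 / r) := by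
  have hr0 : 0 < r := by linarith
  have hEtop (i : ι) : volume (E i) ≠ ∞ :=
    measure_ne_top_of_subset (hEδ i) (volume_freqCube_ne_top δ)
  set F : EuclideanSpace ℝ (Fin n) → ι → X := fun x i => cellKernel (E i) x • g x with hF
  have hFi (i : ι) : Integrable fun x => F x i :=
    hg.bdd_smul (C := (√(volume.real (E i)))⁻¹ * volume.real (E i))
      (continuous_cellKernel _ (hEtop i)).aestronglyMeasurable
      (Filter.Eventually.of_forall fun x => norm_cellKernel_le _ _)
  have hFint : Integrable F := Integrable.of_eval hFi
  have hFeq : (fun i => ∫ x, cellKernel (E i) x • g x) = ∫ x, F x :=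
    funext fun i => (eval_integral hFi i).symm
  rw [hFeq]
  set D : ℝ≥0∞ := ENNReal.ofReal (2 * δ ^ (-(n / 2 : ℝ))) with hD
  have hbound (J : Finset (Fin n → ℤ)) :
      gaussNorm (∑ j ∈ J, ∫ z in tile δ 0, F (z + latticePt δ j)) ≤
        D * τ * ∫⁻ z in tile δ 0, (∑' j, ‖g (z + latticePt δ j)‖ₑ ^ r) ^ (1 / r) := by
    have hi (j : Fin n → ℤ) : IntegrableOn (fun z => F (z + latticePt δ j)) (tile δ 0) :=
      (hFint.comp_add_right _).integrableOn
    rw [← integral_finsetSum _ fun j _ => hi j]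
    refine (gaussNorm_integral_le (integrable_finsetSum _ fun j _ => hi j)).trans ?_
    rw [← lintegral_const_mul' _ _ (ENNReal.mul_ne_top ENNReal.ofReal_ne_top hτ')]
    refine lintegral_mono fun z => ?_
    have h1 : ∑ j ∈ J, F (z + latticePt δ j) =
        fun i => ∑ j : J, cellKernel (E i) (z + latticePt δ j) • g (z + latticePt δ j) := by
      ext i
      rw [Finset.sum_apply, Finset.sum_coe_sort J
        fun j => cellKernel (E i) (z + latticePt δ j) • g (z + latticePt δ j)]
    rw [h1]
    refine ((gaussNorm_cellKernel_le hδ z Subtype.val_injective hE hd hEδ).1 _).trans ?_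
    rw [mul_assoc]
    gcongr
    refine (hτ J _).trans ?_
    gcongr
    rw [Finset.sum_coe_sort J fun j => ‖g (z + latticePt δ j)‖ₑ ^ r]
    exact ENNReal.sum_le_tsum J
  have hlim := (continuous_gaussNorm.tendsto _).comp (hasSum_integral_tile hδ hFint)
  refine (le_of_tendsto hlim (Filter.Eventually.of_forall hbound)).trans ?_
  have hgm : AEMeasurable fun x => ‖g x‖ₑ ^ r := hg.1.enorm.pow_const r
  rw [lintegral_eq_lintegral_tile hδ hgm]
  set G : EuclideanSpace ℝ (Fin n) → ℝ≥0∞ := fun z => ∑' j, ‖g (z + latticePt δ j)‖ₑ ^ r with hG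
  have hGm : AEMeasurable G := AEMeasurable.tsum fun j => hgm.comp_quasiMeasurePreserving
      (measurePreserving_add_right volume (latticePt δ j)).quasiMeasurePreserving
  have h2 := eLpNorm'_le_eLpNorm'_mul_rpow_measure_univ (μ := volume.restrict (tile δ 0)) one_pos hr
    (f := fun z => G z ^ (1 / r)) (hGm.restrict.pow_const _).aestronglyMeasurable
  simp only [eLpNorm', enorm_eq_self, ENNReal.rpow_one, div_one, ← ENNReal.rpow_mul,
    one_div_mul_cancel hr0.ne', Measure.restrict_apply_univ, volume_tile_zero hδ] at h2
  refine (mul_le_mul_right h2 _).trans_eq ?_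
  have h3 : D * (ENNReal.ofReal δ ^ n) ^ (1 - 1 / r) =
      ENNReal.ofReal (2 * δ ^ (n * (1 / 2 - 1 / r))) := by
    rw [hD, ← ENNReal.rpow_natCast, ← ENNReal.rpow_mul, ENNReal.ofReal_rpow_of_pos hδ,
      ← ENNReal.ofReal_mul (by positivity), mul_assoc, ← Real.rpow_add hδ]
    congr 3
    ring
  rw [← h3]
  ring

/-- `L^q` bound for the synthesis of a function from the cell kernels. -/
lemma lintegral_sum_cellKernel_rpow_le {δ : ℝ} (hδ : 0 < δ)
    {E : ι → Set (EuclideanSpace ℝ (Fin n))} (hE : ∀ i, MeasurableSet (E i))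
    (hd : Pairwise (Function.onFun Disjoint E)) (hEδ : ∀ i, E i ⊆ freqCube n δ)
    {r : ℝ} (hr : 0 < r) {κ : ℝ≥0∞}
    (hκ : ∀ (J : Finset (Fin n → ℤ)) (v : J → X),
      (∑ j, ‖v j‖ₑ ^ r) ^ (1 / r) ≤ κ * gaussNorm v) (y : ι → X) :
    (∫⁻ x, ‖∑ i, cellKernel (E i) x • y i‖ₑ ^ r) ^ (1 / r) ≤
      ENNReal.ofReal (2 * δ ^ (n * (1 / r - 1 / 2))) * κ * gaussNorm y := by
  have hEtop (i : ι) : volume (E i) ≠ ∞ :=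
    measure_ne_top_of_subset (hEδ i) (volume_freqCube_ne_top δ)
  have hc (i : ι) := continuous_cellKernel _ (hEtop i)
  set D : ℝ≥0∞ := ENNReal.ofReal (2 * δ ^ (-(n / 2 : ℝ))) with hD
  set h : EuclideanSpace ℝ (Fin n) → X := fun x => ∑ i, cellKernel (E i) x • y i with hh
  have hhc : Continuous h := by fun_prop
  have h1 (z : EuclideanSpace ℝ (Fin n)) :
      ∑' j, ‖h (z + latticePt δ j)‖ₑ ^ r ≤ (κ * (D * gaussNorm y)) ^ r := by
    refine ENNReal.summable.tsum_le_of_sum_le fun J => ?_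
    rw [← Finset.sum_coe_sort J fun j => ‖h (z + latticePt δ j)‖ₑ ^ r,
      ← ENNReal.rpow_le_rpow_iff (z := 1 / r) (by positivity), ← ENNReal.rpow_mul _ r,
      mul_one_div_cancel hr.ne', ENNReal.rpow_one]
    refine (hκ J _).trans ?_
    gcongr
    exact (gaussNorm_cellKernel_le hδ z Subtype.val_injective hE hd hEδ).2 y
  rw [lintegral_eq_lintegral_tile hδ (hhc.enorm.measurable.pow_const r).aemeasurable]
  refine (ENNReal.rpow_le_rpow (lintegral_mono h1) (by positivity)).trans_eq ?_
  rw [setLIntegral_const, volume_tile_zero hδ, ENNReal.mul_rpow_of_nonneg _ _ (by positivity),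
    ← ENNReal.rpow_mul _ r, mul_one_div_cancel hr.ne', ENNReal.rpow_one]
  have h3 : D * (ENNReal.ofReal δ ^ n) ^ (1 / r) =
      ENNReal.ofReal (2 * δ ^ (n * (1 / r - 1 / 2))) := by
    rw [hD, ← ENNReal.rpow_natCast, ← ENNReal.rpow_mul, ENNReal.ofReal_rpow_of_pos hδ,
      ← ENNReal.ofReal_mul (by positivity), mul_assoc, ← Real.rpow_add hδ]
    congr 3
    ring
  rw [← h3]
  ring

end KernelBounds

section Dyadic

/-- The sum of the geometric series of ratio `2 ^ (-γ)`. -/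
noncomputable def geomConst (γ : ℝ) : ℝ≥0∞ := (1 - (2 : ℝ≥0∞) ^ (-γ))⁻¹

lemma two_rpow_neg_lt_one {γ : ℝ} (hγ : 0 < γ) : (2 : ℝ≥0∞) ^ (-γ) < 1 :=
  ENNReal.rpow_lt_one_of_one_lt_of_neg (by norm_num) (by linarith)

lemma geomConst_ne_top {γ : ℝ} (hγ : 0 < γ) : geomConst γ ≠ ∞ := by
  rw [geomConst, Ne, ENNReal.inv_eq_top, tsub_eq_zero_iff_le, not_le]
  exact two_rpow_neg_lt_one hγ

lemma geomConst_ne_zero (γ : ℝ) : geomConst γ ≠ 0 := by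
  rw [geomConst, Ne, ENNReal.inv_eq_zero]
  exact (tsub_le_self.trans_lt ENNReal.one_lt_top).ne

lemma two_rpow_ne_top (γ : ℝ) : (2 : ℝ≥0∞) ^ γ ≠ ∞ := by simp [ENNReal.rpow_eq_top_iff]

lemma two_rpow_add (a b : ℝ) : (2 : ℝ≥0∞) ^ (a + b) = 2 ^ a * 2 ^ b :=
  ENNReal.rpow_add _ _ (by norm_num) (by norm_num)

lemma sum_two_rpow_le {γ : ℝ} (S : Finset ℤ) {t : ℝ≥0∞}
    (hS : ∀ k ∈ S, (2 : ℝ≥0∞) ^ (γ * k) ≤ t) :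
    ∑ k ∈ S, (2 : ℝ≥0∞) ^ (γ * k) ≤ geomConst γ * t := by
  rcases S.eq_empty_or_nonempty with rfl | hne
  · simp
  set K := S.max' hne
  have hle : ∀ k ∈ S, k ≤ K := fun k hk => S.le_max' k hk
  have h1 : ∀ k ∈ S, (2 : ℝ≥0∞) ^ (γ * k) =
      2 ^ (γ * K) * ((2 : ℝ≥0∞) ^ (-γ)) ^ (K - k).toNat := by
    intro k hk
    rw [← ENNReal.rpow_natCast, ← ENNReal.rpow_mul, ← two_rpow_add]
    congr 1
    have h2 : (((K - k).toNat : ℤ) : ℝ) = ((K - k : ℤ) : ℝ) := by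
      rw [Int.toNat_of_nonneg (sub_nonneg.2 (hle k hk))]
    rw [Int.cast_natCast] at h2
    rw [h2]
    push_cast
    ring
  rw [Finset.sum_congr rfl h1, ← Finset.mul_sum, mul_comm (geomConst γ)]
  refine mul_le_mul' (hS K (S.max'_mem hne)) ?_
  rw [← Finset.sum_image (g := fun k : ℤ => (K - k).toNat)
    (f := fun i : ℕ => ((2 : ℝ≥0∞) ^ (-γ)) ^ i)]
  · exact (ENNReal.sum_le_tsum _).trans_eq (ENNReal.tsum_geometric _)
  · intro k hk k' hk' h
    have h3 := hle k hk
    have h4 := hle k' hk'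
    simp only at h
    omega

lemma sum_two_rpow_neg_mul_le {γ : ℝ} (S : Finset ℤ) {t : ℝ≥0∞}
    (hS : ∀ k ∈ S, t ≤ (2 : ℝ≥0∞) ^ (γ * k)) :
    (∑ k ∈ S, (2 : ℝ≥0∞) ^ (-(γ * k))) * t ≤ geomConst γ := by
  have h1 := sum_two_rpow_le (γ := γ) (S.image fun k => -k) (t := t⁻¹) (by
    intro k' hk'
    obtain ⟨k, hk, rfl⟩ := Finset.mem_image.1 hk'
    have := ENNReal.inv_le_inv.2 (hS k hk)
    rw [← ENNReal.rpow_neg] at this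
    convert this using 2
    push_cast
    ring)
  rw [Finset.sum_image (by intro _ _ _ _ h; simpa using h)] at h1
  have h2 : ∑ k ∈ S, (2 : ℝ≥0∞) ^ (-(γ * k)) ≤ geomConst γ * t⁻¹ := by
    convert h1 using 3
    push_cast
    ring
  refine (mul_le_mul_left h2 t).trans ?_
  rw [mul_assoc]
  exact mul_le_of_le_one_right zero_le (ENNReal.inv_mul_le_one t)

/-- Pointwise dyadic summation: pieces of size at most `2 ^ (η k)`. -/
lemma rpow_sum_le_sum_rpow {η q₀ q : ℝ} (hη : 0 < η) (hq₀ : 1 < q₀) (hq : q₀ < q) :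
    ∃ C : ℝ≥0∞, C ≠ ∞ ∧ ∀ (S : Finset ℤ) (b : ℤ → ℝ≥0∞),
      (∀ k, b k ≤ 2 ^ (η * k)) →
      (∑ k ∈ S, b k) ^ q ≤ C * ∑ k ∈ S, 2 ^ (η * (q - q₀) * k) * b k ^ q₀ := by
  classical
  set q' := q₀.conjExponent
  have hc : q₀.HolderConjugate q' := Real.HolderConjugate.conjExponent hq₀
  have hq0 : 0 < q₀ := by linarith
  have hq'0 : 0 < q' := hc.symm.pos
  set γ := η * (q - q₀) * q' / q₀ with hγdef
  have hγ : 0 < γ := by have := sub_pos.2 hq; positivity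
  set G := geomConst η
  have hG0 : G ≠ 0 := geomConst_ne_zero η
  have hGt : G ≠ ∞ := geomConst_ne_top hη
  refine ⟨geomConst γ ^ (q₀ / q') * 2 ^ q₀ * (2 * G) ^ (q - q₀), ?_, fun S b hb => ?_⟩
  · have h1 : 0 ≤ q - q₀ := by linarith
    exact ENNReal.mul_ne_top (ENNReal.mul_ne_top
      (ENNReal.rpow_ne_top_of_nonneg (by positivity) (geomConst_ne_top hγ))
      (two_rpow_ne_top _)) (ENNReal.rpow_ne_top_of_nonneg h1 (ENNReal.mul_ne_top (by norm_num) hGt))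
  set T := ∑ k ∈ S, b k with hT
  set R := ∑ k ∈ S, (2 : ℝ≥0∞) ^ (η * (q - q₀) * k) * b k ^ q₀ with hR
  have hTt : T ≠ ∞ := ENNReal.sum_ne_top.2 fun k _ => ne_top_of_le_ne_top (two_rpow_ne_top _) (hb k)
  have h2G0 : 2 * G ≠ 0 := mul_ne_zero (by norm_num) hG0
  have h2Gt : 2 * G ≠ ∞ := ENNReal.mul_ne_top (by norm_num) hGt
  set t := T / (2 * G) with ht
  have hTG : T = t * (2 * G) := (ENNReal.div_mul_cancel h2G0 h2Gt).symm
  set L := S.filter fun k : ℤ => (2 : ℝ≥0∞) ^ (η * k) ≤ t with hL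
  set H := S.filter fun k : ℤ => ¬ (2 : ℝ≥0∞) ^ (η * k) ≤ t with hH
  have hlow : ∑ k ∈ L, b k ≤ T / 2 := by
    refine (Finset.sum_le_sum fun k _ => hb k).trans
      ((sum_two_rpow_le L fun k hk => (Finset.mem_filter.1 hk).2).trans_eq ?_)
    rw [hTG, ← mul_assoc, mul_comm t 2, mul_assoc, ENNReal.mul_div_right_comm,
      ENNReal.div_self (by norm_num) (by norm_num), one_mul, mul_comm]
  have hhigh : T / 2 ≤ ∑ k ∈ H, b k := by
    have h1 : T / 2 + T / 2 ≤ T / 2 + ∑ k ∈ H, b k := by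
      calc T / 2 + T / 2 = ∑ k ∈ L, b k + ∑ k ∈ H, b k := by
            rw [ENNReal.add_halves]
            exact (Finset.sum_filter_add_sum_filter_not S _ _).symm
        _ ≤ _ := add_le_add_left hlow _
    exact (ENNReal.add_le_add_iff_left (ENNReal.div_ne_top hTt (by norm_num))).1 h1
  have hhol : ∑ k ∈ H, b k ≤ R ^ (1 / q₀) * (∑ k ∈ H, (2 : ℝ≥0∞) ^ (-(γ * k))) ^ (1 / q') := by
    have h1 := ENNReal.inner_le_Lp_mul_Lq H
      (fun k => (2 : ℝ≥0∞) ^ (η * (q - q₀) * k / q₀) * b k)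
      (fun k => (2 : ℝ≥0∞) ^ (-(η * (q - q₀) * k / q₀))) hc
    refine le_trans (le_of_eq ?_) (h1.trans ?_)
    · refine Finset.sum_congr rfl fun k _ => ?_
      rw [mul_right_comm, ← two_rpow_add, add_neg_cancel, ENNReal.rpow_zero, one_mul]
    · refine mul_le_mul' (ENNReal.rpow_le_rpow ?_ (by positivity)) (le_of_eq ?_)
      · refine le_trans (le_of_eq (Finset.sum_congr rfl fun k _ => ?_))
          (Finset.sum_le_sum_of_subset (Finset.filter_subset _ S))
        rw [ENNReal.mul_rpow_of_nonneg _ _ hq0.le, ← ENNReal.rpow_mul, div_mul_cancel₀ _ hq0.ne']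
      · congr 1
        refine Finset.sum_congr rfl fun k _ => ?_
        rw [← ENNReal.rpow_mul]
        congr 1
        rw [hγdef]
        ring
  have hgeo : (∑ k ∈ H, (2 : ℝ≥0∞) ^ (-(γ * k))) * t ^ (γ / η) ≤ geomConst γ := by
    refine sum_two_rpow_neg_mul_le H fun k hk => ?_
    have h1 := ENNReal.rpow_le_rpow (not_le.1 (Finset.mem_filter.1 hk).2).le
      (by positivity : 0 ≤ γ / η)
    rw [← ENNReal.rpow_mul] at h1
    convert h1 using 2
    field_simp
  have hfin : (T / 2) ^ q₀ * t ^ (q - q₀) ≤ R * geomConst γ ^ (q₀ / q') := by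
    calc (T / 2) ^ q₀ * t ^ (q - q₀)
        ≤ (R ^ (1 / q₀) * (∑ k ∈ H, (2 : ℝ≥0∞) ^ (-(γ * k))) ^ (1 / q')) ^ q₀ * t ^ (q - q₀) := by
          gcongr
          exact hhigh.trans hhol
      _ = R * ((∑ k ∈ H, (2 : ℝ≥0∞) ^ (-(γ * k))) * t ^ (γ / η)) ^ (q₀ / q') := by
          rw [ENNReal.mul_rpow_of_nonneg _ _ hq0.le, ← ENNReal.rpow_mul, ← ENNReal.rpow_mul,
            one_div_mul_cancel hq0.ne', ENNReal.rpow_one,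
            ENNReal.mul_rpow_of_nonneg _ _ (by positivity : 0 ≤ q₀ / q'), ← ENNReal.rpow_mul,
            mul_assoc]
          congr 3
          · ring
          · rw [hγdef]; field_simp
      _ ≤ _ := by gcongr
  calc T ^ q = (T / 2 * 2) ^ q₀ * (t * (2 * G)) ^ (q - q₀) := by
        rw [ENNReal.div_mul_cancel (by norm_num) (by norm_num), ← hTG,
          ← ENNReal.rpow_add_of_nonneg _ _ hq0.le (by linarith)]
        congr 1
        ring
    _ = ((T / 2) ^ q₀ * t ^ (q - q₀)) * (2 ^ q₀ * (2 * G) ^ (q - q₀)) := by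
        rw [ENNReal.mul_rpow_of_nonneg _ _ hq0.le, ENNReal.mul_rpow_of_nonneg _ _ (by linarith)]
        ring
    _ ≤ (R * geomConst γ ^ (q₀ / q')) * (2 ^ q₀ * (2 * G) ^ (q - q₀)) := by gcongr
    _ = _ := by ring

lemma sum_rpow_le_rpow_sum {ι : Type*} (S : Finset ι) (a : ι → ℝ≥0∞) {r : ℝ} (hr : 1 ≤ r) :
    ∑ i ∈ S, a i ^ r ≤ (∑ i ∈ S, a i) ^ r := by
  classical
  induction S using Finset.induction_on with
  | empty => simp
  | insert i S hi ih =>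
    rw [Finset.sum_insert hi, Finset.sum_insert hi]
    exact (add_le_add_right ih _).trans (ENNReal.add_rpow_le_rpow_add _ _ hr)

/-- Dyadic summation of the truncations of an `L^p` function. -/
lemma sum_truncation_rpow_le {ρ p p₀ : ℝ} (hρ : 0 < ρ) (hp : 1 < p) (hpp : p < p₀) :
    ∃ C : ℝ≥0∞, C ≠ ∞ ∧ ∀ {α : Type} [MeasurableSpace α] (μ : Measure α) (f : α → ℝ≥0∞)
      (S : Finset ℤ), Measurable f → ∫⁻ a, f a ^ p ∂μ ≤ 1 →
      ∑ k ∈ S, (2 ^ (ρ * (p - 1) * k) * ∫⁻ a, (if 2 ^ (ρ * k) < f a then f a else 0) ∂μ +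
        2 ^ (-(ρ * (1 - p / p₀) * k)) *
          (∫⁻ a, (if 2 ^ (ρ * k) < f a then 0 else f a) ^ p₀ ∂μ) ^ (1 / p₀)) ^ p₀ ≤ C := by
  have hp₀ : 0 < p₀ := by linarith
  have hγ1 : 0 < ρ * (p - 1) := mul_pos hρ (by linarith)
  have hγ2 : 0 < ρ * (p₀ - p) := mul_pos hρ (by linarith)
  refine ⟨2 ^ (p₀ - 1) * (geomConst (ρ * (p - 1)) ^ p₀ + geomConst (ρ * (p₀ - p))),
    ENNReal.mul_ne_top (two_rpow_ne_top _) (ENNReal.add_ne_top.2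
      ⟨ENNReal.rpow_ne_top_of_nonneg hp₀.le (geomConst_ne_top hγ1), geomConst_ne_top hγ2⟩), ?_⟩
  intro α _ μ f S hf h1
  refine (Finset.sum_le_sum fun k _ => ENNReal.rpow_add_le_mul_rpow_add_rpow _ _ (by linarith)).trans ?_
  rw [← Finset.mul_sum, Finset.sum_add_distrib]
  have hset (k : ℤ) : MeasurableSet {a | (2 : ℝ≥0∞) ^ (ρ * k) < f a} := measurableSet_lt measurable_const hf
  gcongr
  · refine (sum_rpow_le_rpow_sum S _ (by linarith)).trans ?_
    gcongr
    have hm (k : ℤ) : Measurable fun a => if (2 : ℝ≥0∞) ^ (ρ * k) < f a then f a else 0 :=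
      Measurable.ite (hset k) hf measurable_const
    simp_rw [← lintegral_const_mul _ (hm _)]
    rw [← lintegral_finsetSum _ fun k _ => (hm k).const_mul _]
    calc ∫⁻ a, ∑ k ∈ S, 2 ^ (ρ * (p - 1) * k) * (if 2 ^ (ρ * k) < f a then f a else 0) ∂μ
        ≤ ∫⁻ a, geomConst (ρ * (p - 1)) * f a ^ p ∂μ := lintegral_mono fun a => ?_
      _ ≤ geomConst (ρ * (p - 1)) * 1 := by
          rw [lintegral_const_mul _ (hf.pow_const _)]
          gcongr
      _ = _ := mul_one _
    simp only [mul_ite, mul_zero]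
    rw [← Finset.sum_filter, ← Finset.sum_mul]
    have h2 := sum_two_rpow_le (γ := ρ * (p - 1)) (S.filter fun k : ℤ => (2 : ℝ≥0∞) ^ (ρ * k) < f a)
      (t := f a ^ (p - 1)) fun k hk => by
        have := ENNReal.rpow_le_rpow (Finset.mem_filter.1 hk).2.le (by linarith : 0 ≤ p - 1)
        rw [← ENNReal.rpow_mul] at this
        convert this using 2
        ring
    refine (mul_le_mul_left h2 _).trans_eq ?_
    rw [mul_assoc]
    nth_rewrite 2 [← ENNReal.rpow_one (f a)]
    rw [← ENNReal.rpow_add_of_nonneg _ _ (by linarith) (by norm_num), sub_add_cancel]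
  · have hm (k : ℤ) : Measurable fun a => (if (2 : ℝ≥0∞) ^ (ρ * k) < f a then 0 else f a) ^ p₀ :=
      (Measurable.ite (hset k) measurable_const hf).pow_const _
    have h3 (k : ℤ) : (2 ^ (-(ρ * (1 - p / p₀) * k)) *
        (∫⁻ a, (if 2 ^ (ρ * k) < f a then 0 else f a) ^ p₀ ∂μ) ^ (1 / p₀)) ^ p₀ =
        ∫⁻ a, 2 ^ (-(ρ * (p₀ - p) * k)) * (if 2 ^ (ρ * k) < f a then 0 else f a) ^ p₀ ∂μ := by
      rw [lintegral_const_mul _ (hm k), ENNReal.mul_rpow_of_nonneg _ _ hp₀.le, ← ENNReal.rpow_mul,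
        ← ENNReal.rpow_mul, one_div_mul_cancel hp₀.ne', ENNReal.rpow_one]
      congr 2
      field_simp
    simp_rw [h3]
    rw [← lintegral_finsetSum _ fun k _ => (hm k).const_mul _]
    calc _ ≤ ∫⁻ a, geomConst (ρ * (p₀ - p)) * f a ^ p ∂μ := lintegral_mono fun a => ?_
      _ ≤ geomConst (ρ * (p₀ - p)) * 1 := by
          rw [lintegral_const_mul _ (hf.pow_const _)]
          gcongr
      _ = _ := mul_one _
    have h4 : ∑ k ∈ S, (2 : ℝ≥0∞) ^ (-(ρ * (p₀ - p) * k)) *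
        (if 2 ^ (ρ * k) < f a then 0 else f a) ^ p₀ =
        (∑ k ∈ S.filter (fun k : ℤ => ¬ (2 : ℝ≥0∞) ^ (ρ * k) < f a),
          (2 : ℝ≥0∞) ^ (-(ρ * (p₀ - p) * k))) * f a ^ p₀ := by
      rw [Finset.sum_filter, Finset.sum_mul]
      refine Finset.sum_congr rfl fun k _ => ?_
      split_ifs <;> simp [hp₀]
    rw [h4]
    have h5 := sum_two_rpow_neg_mul_le (γ := ρ * (p₀ - p))
      (S.filter (fun k : ℤ => ¬ (2 : ℝ≥0∞) ^ (ρ * k) < f a)) (t := f a ^ (p₀ - p)) fun k hk => by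
        have := ENNReal.rpow_le_rpow (not_lt.1 (Finset.mem_filter.1 hk).2)
          (by linarith : 0 ≤ p₀ - p)
        rw [← ENNReal.rpow_mul] at this
        convert this using 2
        ring
    refine le_trans (le_of_eq ?_) (mul_le_mul_left h5 (f a ^ p))
    rw [mul_assoc, ← ENNReal.rpow_add_of_nonneg _ _ (by linarith) (by linarith), sub_add_cancel]

end Dyadic

section Annuli

variable {n : ℕ}

/-- Gaussian type `r` with constant `τ`, in block form. -/
def HasGaussType (X : Type*) [NormedAddCommGroup X] [NormedSpace ℝ X] (r : ℝ) (τ : ℝ≥0∞) : Prop :=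
  ∀ {ι β : Type} [Fintype ι] [Fintype β] [DecidableEq β] (b : ι → β) (x : ι → X),
    gaussNorm x ≤ τ * (∑ j, gaussNorm (fun i => if b i = j then x i else 0) ^ r) ^ (1 / r)

/-- Gaussian cotype `r` with constant `κ`, in block form. -/
def HasGaussCotype (Y : Type*) [NormedAddCommGroup Y] [NormedSpace ℝ Y] (r : ℝ) (κ : ℝ≥0∞) : Prop :=
  ∀ {ι β : Type} [Fintype ι] [Fintype β] [DecidableEq β] (b : ι → β) (y : ι → Y),
    (∑ j, gaussNorm (fun i => if b i = j then y i else 0) ^ r) ^ (1 / r) ≤ κ * gaussNorm y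

/-- The dyadic annulus `2 ^ k ≤ |ξ| < 2 ^ (k + 1)`. -/
def annulus (n : ℕ) (k : ℤ) : Set (EuclideanSpace ℝ (Fin n)) :=
  {ξ | (2 : ℝ) ^ (k : ℝ) ≤ ‖ξ‖ ∧ ‖ξ‖ < (2 : ℝ) ^ (k + 1 : ℝ)}

/-- The scale of a cube containing the annulus of index `k`. -/
noncomputable def annScale (k : ℤ) : ℝ := (2 : ℝ) ^ (-(k + 2) : ℝ)

lemma annScale_pos (k : ℤ) : 0 < annScale k := by unfold annScale; positivity

lemma ofReal_two_rpow (x : ℝ) : ENNReal.ofReal ((2 : ℝ) ^ x) = 2 ^ x := by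
  rw [← ENNReal.ofReal_rpow_of_pos (by norm_num)]
  norm_num

lemma ofReal_two_mul_annScale_rpow (k : ℤ) (e : ℝ) :
    ENNReal.ofReal (2 * annScale k ^ e) = 2 ^ (1 - 2 * e) * 2 ^ (-(e * k)) := by
  rw [annScale, ← Real.rpow_mul (by norm_num), ← two_rpow_add, ← ofReal_two_rpow]
  nth_rewrite 1 [← Real.rpow_one 2]
  rw [← Real.rpow_add (by norm_num)]
  congr 2
  ring

lemma annulus_subset_freqCube {k K : ℤ} (h : k ≤ K) :
    annulus n k ⊆ freqCube n (annScale K) := by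
  intro ξ hξ l
  have h1 : 1 / (2 * annScale K) = (2 : ℝ) ^ (K + 1 : ℝ) := by
    have h2 : 2 * annScale K = (2 : ℝ) ^ (-(K + 1 : ℝ)) := by
      rw [annScale]
      nth_rewrite 1 [← Real.rpow_one 2]
      rw [← Real.rpow_add (by norm_num)]
      congr 1
      ring
    rw [h2, Real.rpow_neg (by norm_num), one_div, inv_inv]
  have h3 : |ξ l| < (2 : ℝ) ^ (K + 1 : ℝ) := by
    refine ((PiLp.norm_apply_le ξ l).trans_lt hξ.2).trans_le ?_
    have : (k : ℝ) ≤ K := by exact_mod_cast h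
    exact Real.rpow_le_rpow_of_exponent_le (by norm_num) (by linarith)
  rw [h1]
  exact ⟨(abs_lt.1 h3).1, (abs_lt.1 h3).2.le⟩

lemma cellKernel_empty (x : EuclideanSpace ℝ (Fin n)) : cellKernel ∅ x = 0 := by simp [cellKernel]

lemma le_mul_of_forall_scaling {Φ g C : ℝ≥0∞} (hC : C ≠ ∞) (hg : g ≠ ∞)
    (h : ∀ c : ℝ, 0 < c → ENNReal.ofReal c * g ≤ 1 → ENNReal.ofReal c * Φ ≤ C) : Φ ≤ C * g := by
  rcases eq_or_ne g 0 with rfl | h0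
  · rw [mul_zero, nonpos_iff_eq_zero]
    by_contra hΦ
    obtain ⟨N, hN⟩ := ENNReal.exists_nat_mul_gt hΦ hC
    have h1 := h (N + 1) (by positivity) (by simp)
    refine absurd (h1.trans_lt hN) (not_lt.2 ?_)
    gcongr
    rw [← ENNReal.ofReal_natCast]
    exact ENNReal.ofReal_le_ofReal (by linarith)
  · have h1 := h g.toReal⁻¹ (inv_pos.2 (ENNReal.toReal_pos h0 hg))
    rw [ENNReal.ofReal_inv_of_pos (ENNReal.toReal_pos h0 hg), ENNReal.ofReal_toReal hg] at h1
    have h2 := h1 (ENNReal.inv_mul_le_one g)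
    calc Φ = (g⁻¹ * Φ) * g := by
          rw [mul_right_comm, ENNReal.inv_mul_cancel h0 hg, one_mul]
      _ ≤ C * g := by gcongr

end Annuli

section SideX

variable {n : ℕ} {X : Type*} [NormedAddCommGroup X] [NormedSpace ℂ X] [CompleteSpace X]

lemma HasGaussType.pointwise {X : Type*} [NormedAddCommGroup X] [NormedSpace ℝ X] [CompleteSpace X]
    {r : ℝ} {τ : ℝ≥0∞} (h : HasGaussType X r τ)
    {β : Type} (J : Finset β) (v : J → X) :
    gaussNorm v ≤ τ * (∑ j, ‖v j‖ₑ ^ r) ^ (1 / r) := by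
  classical
  have h1 := h id v
  have h2 (j : J) : (fun i => if id i = j then v i else 0) = fun i => if i = j then v j else 0 := by
    ext i
    simp only [id]
    split_ifs with h <;> simp [h]
  simpa only [h2, gaussNorm_single] using h1

lemma HasGaussCotype.pointwise {X : Type*} [NormedAddCommGroup X] [NormedSpace ℝ X] [CompleteSpace X]
    {r : ℝ} {κ : ℝ≥0∞} (h : HasGaussCotype X r κ)
    {β : Type} (J : Finset β) (v : J → X) :
    (∑ j, ‖v j‖ₑ ^ r) ^ (1 / r) ≤ κ * gaussNorm v := by
  classical
  have h1 := h id v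
  have h2 (j : J) : (fun i => if id i = j then v i else 0) = fun i => if i = j then v j else 0 := by
    ext i
    simp only [id]
    split_ifs with h <;> simp [h]
  simpa only [h2, gaussNorm_single] using h1

lemma gaussNorm_zero {ι X : Type*} [Fintype ι] [NormedAddCommGroup X] [NormedSpace ℝ X] :
    gaussNorm (fun _ : ι => (0 : X)) = 0 := by simp [gaussNorm]

lemma gaussNorm_sum_le {ι κ X : Type*} [Fintype ι] [NormedAddCommGroup X] [NormedSpace ℝ X]
    (S : Finset κ) (x : κ → ι → X) : gaussNorm (∑ j ∈ S, x j) ≤ ∑ j ∈ S, gaussNorm (x j) := by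
  classical
  induction S using Finset.induction_on with
  | empty => exact gaussNorm_zero.le
  | insert j S hj ih =>
    rw [Finset.sum_insert hj, Finset.sum_insert hj]
    exact (gaussNorm_add_le _ _).trans (add_le_add_right ih _)

lemma hasGaussType_one (X : Type*) [NormedAddCommGroup X] [NormedSpace ℝ X] : HasGaussType X 1 1 := by
  intro ι β _ _ _ b x
  simp only [ENNReal.rpow_one, div_one, one_mul]
  refine le_trans (le_of_eq ?_) (gaussNorm_sum_le Finset.univ fun j i => if b i = j then x i else 0)
  congr 1
  ext i
  simp

/-- The cells in the annulus of index `k`, the other ones being emptied. -/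
def cellsAt {ι : Type} (E : ι → Set (EuclideanSpace ℝ (Fin n))) (b : ι → ℤ) (k : ℤ) (i : ι) :
    Set (EuclideanSpace ℝ (Fin n)) := {ξ | b i = k ∧ ξ ∈ E i}

variable {ι : Type} {E : ι → Set (EuclideanSpace ℝ (Fin n))} {b : ι → ℤ}

lemma cellsAt_of_eq {k : ℤ} {i : ι} (h : b i = k) : cellsAt E b k i = E i := by
  ext; simp [cellsAt, h]

lemma cellsAt_of_ne {k : ℤ} {i : ι} (h : b i ≠ k) : cellsAt E b k i = ∅ := by
  ext; simp [cellsAt, h]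

lemma measurableSet_cellsAt (hE : ∀ i, MeasurableSet (E i)) (k : ℤ) (i : ι) :
    MeasurableSet (cellsAt E b k i) := by
  by_cases h : b i = k
  · rw [cellsAt_of_eq h]; exact hE i
  · rw [cellsAt_of_ne h]; exact .empty

lemma pairwise_disjoint_cellsAt (hd : Pairwise (Function.onFun Disjoint E)) (k : ℤ) :
    Pairwise (Function.onFun Disjoint (cellsAt E b k)) := fun _ _ hij =>
  (hd hij).mono (fun _ h => h.2) (fun _ h => h.2)

lemma cellsAt_subset (hEa : ∀ i, E i ⊆ annulus n (b i)) (k : ℤ) (i : ι) :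
    cellsAt E b k i ⊆ freqCube n (annScale k) := by
  rintro ξ ⟨rfl, h⟩
  exact annulus_subset_freqCube le_rfl (hEa i h)

/-- The estimate of the coefficients belonging to one annulus. -/
lemma gaussNorm_block_le [Fintype ι] (hE : ∀ i, MeasurableSet (E i))
    (hd : Pairwise (Function.onFun Disjoint E)) (hEa : ∀ i, E i ⊆ annulus n (b i))
    {r : ℝ} (hr : 1 ≤ r) {τ : ℝ≥0∞} (hτ' : τ ≠ ∞) (hτ : HasGaussType X r τ)
    {g : EuclideanSpace ℝ (Fin n) → X} (hg : Integrable g) (k : ℤ) :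
    gaussNorm (fun i => if b i = k then ∫ x, cellKernel (E i) x • g x else 0) ≤
      2 ^ (1 - 2 * (n * (1 / 2 - 1 / r))) * 2 ^ (-(n * (1 / 2 - 1 / r) * k)) * τ *
        (∫⁻ x, ‖g x‖ₑ ^ r) ^ (1 / r) := by
  have h1 := gaussNorm_integral_cellKernel_le (annScale_pos k) (measurableSet_cellsAt hE k)
    (pairwise_disjoint_cellsAt hd k) (cellsAt_subset hEa k) hr hτ' (fun J v => hτ.pointwise J v) hg
  rw [ofReal_two_mul_annScale_rpow] at h1
  refine le_trans (le_of_eq ?_) h1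
  congr 1
  ext i
  split_ifs with h
  · rw [cellsAt_of_eq h]
  · simp [cellsAt_of_ne h, cellKernel_empty]

end SideX

section TypeEstimate

variable {n : ℕ} {X : Type*} [NormedAddCommGroup X] [NormedSpace ℂ X] [CompleteSpace X]

lemma volume_ne_top_of_subset_annulus {E : Set (EuclideanSpace ℝ (Fin n))} {k : ℤ}
    (h : E ⊆ annulus n k) : volume E ≠ ∞ :=
  measure_ne_top_of_subset (h.trans (annulus_subset_freqCube le_rfl)) (volume_freqCube_ne_top _)

lemma integrable_cellKernel_smul {X : Type*} [NormedAddCommGroup X] [NormedSpace ℂ X]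
    {E : Set (EuclideanSpace ℝ (Fin n))} (hE : volume E ≠ ∞)
    {f : EuclideanSpace ℝ (Fin n) → X} (hf : Integrable f) :
    Integrable fun x => cellKernel E x • f x :=
  hf.bdd_smul _ (continuous_cellKernel E hE).aestronglyMeasurable
    (Filter.Eventually.of_forall (norm_cellKernel_le E))

lemma gaussNorm_ite_smul {ι Y : Type*} [Fintype ι] [NormedAddCommGroup Y] [NormedSpace ℝ Y]
    (b : ι → ℤ) (s : ℝ) (k : ℤ) (x : ι → Y) :
    gaussNorm (fun i => if b i = k then (2 : ℝ) ^ (-(s * b i)) • x i else 0) =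
      2 ^ (-(s * k)) * gaussNorm (fun i => if b i = k then x i else 0) := by
  have h1 : (fun i => if b i = k then (2 : ℝ) ^ (-(s * b i)) • x i else 0) =
      (2 : ℝ) ^ (-(s * k)) • fun i => if b i = k then x i else 0 := by
    ext i
    simp only [Pi.smul_apply]
    split_ifs with h
    · rw [h]
    · rw [smul_zero]
  rw [h1, gaussNorm_smul, Real.enorm_of_nonneg (by positivity), ofReal_two_rpow]

lemma gaussNorm_block_le_truncation {ι : Type} [Fintype ι]
    {E : ι → Set (EuclideanSpace ℝ (Fin n))} {b : ι → ℤ} (hE : ∀ i, MeasurableSet (E i))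
    (hd : Pairwise (Function.onFun Disjoint E)) (hEa : ∀ i, E i ⊆ annulus n (b i))
    {p p₀ : ℝ} (hp : 0 < p) (hp₀ : 1 ≤ p₀) {τ : ℝ≥0∞} (hτ' : τ ≠ ∞) (hτ : HasGaussType X p₀ τ)
    {f : EuclideanSpace ℝ (Fin n) → X} (hf : Integrable f) (hfm : StronglyMeasurable f) (k : ℤ) :
    gaussNorm (fun i => if b i = k then
        (2 : ℝ) ^ (-((n / p - n / 2) * b i)) • ∫ x, cellKernel (E i) x • f x else 0) ≤
      (2 ^ (1 + n : ℝ) + 2 ^ (1 - 2 * (n * (1 / 2 - 1 / p₀))) * τ) *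
        (2 ^ (n / p * (p - 1) * k) *
          (∫⁻ x, (if 2 ^ (n / p * k) < ‖f x‖ₑ then ‖f x‖ₑ else 0)) +
        2 ^ (-(n / p * (1 - p / p₀) * k)) *
          (∫⁻ x, (if 2 ^ (n / p * k) < ‖f x‖ₑ then 0 else ‖f x‖ₑ) ^ p₀) ^ (1 / p₀)) := by
  set A : Set (EuclideanSpace ℝ (Fin n)) := {x | 2 ^ (n / p * k) < ‖f x‖ₑ} with hA
  have hAm : MeasurableSet A := measurableSet_lt measurable_const hfm.enorm
  have h1 := gaussNorm_block_le hE hd hEa le_rfl one_ne_top (hasGaussType_one X)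
    (hf.indicator hAm) k
  have h2 := gaussNorm_block_le hE hd hEa hp₀ hτ' hτ (hf.indicator hAm.compl) k
  have hb (i : ι) {B : Set (EuclideanSpace ℝ (Fin n))} (hB : MeasurableSet B) :
      Integrable fun x => cellKernel (E i) x • B.indicator f x := by
    exact integrable_cellKernel_smul (volume_ne_top_of_subset_annulus (hEa i)) (hf.indicator hB)
  have hsplit : (fun i => if b i = k then ∫ x, cellKernel (E i) x • f x else 0) =
      (fun i => if b i = k then ∫ x, cellKernel (E i) x • A.indicator f x else 0) +
      (fun i => if b i = k then ∫ x, cellKernel (E i) x • Aᶜ.indicator f x else 0) := by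
    ext i
    simp only [Pi.add_apply]
    split_ifs
    · rw [← integral_add (hb i hAm) (hb i hAm.compl)]
      congr 1
      ext x
      rw [← smul_add, Set.indicator_self_add_compl_apply]
    · simp
  rw [gaussNorm_ite_smul, hsplit]
  have e1 : ∫⁻ x, ‖A.indicator f x‖ₑ ^ (1 : ℝ) =
      ∫⁻ x, (if 2 ^ (n / p * k) < ‖f x‖ₑ then ‖f x‖ₑ else 0) := by
    congr 1; ext x
    by_cases h : x ∈ A
    · rw [Set.indicator_of_mem h, ENNReal.rpow_one, if_pos (show _ < _ from h)]
    · rw [Set.indicator_of_notMem h, ENNReal.rpow_one, if_neg (show ¬ _ < _ from h), enorm_zero]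
  have e2 : ∫⁻ x, ‖Aᶜ.indicator f x‖ₑ ^ p₀ =
      ∫⁻ x, (if 2 ^ (n / p * k) < ‖f x‖ₑ then 0 else ‖f x‖ₑ) ^ p₀ := by
    congr 1; ext x
    by_cases h : x ∈ A
    · rw [Set.indicator_of_notMem (by simpa using h), if_pos (show _ < _ from h), enorm_zero,
        ENNReal.zero_rpow_of_pos (by linarith)]
    · rw [Set.indicator_of_mem h, if_neg (show ¬ _ < _ from h)]
  rw [e1] at h1
  rw [e2] at h2
  refine (mul_le_mul_right ((gaussNorm_add_le _ _).trans (add_le_add h1 h2)) _).trans ?_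
  simp only [div_one, ENNReal.rpow_one, mul_one, mul_add]
  have e3 : (2 : ℝ≥0∞) ^ (-((n / p - n / 2) * k)) * 2 ^ (-(n * (1 / 2 - 1) * k : ℝ)) =
      2 ^ (n / p * (p - 1) * k) := by
    rw [← two_rpow_add]; congr 1; field_simp; ring
  have e4 : (2 : ℝ≥0∞) ^ (-((n / p - n / 2) * k)) * 2 ^ (-(n * (1 / 2 - 1 / p₀) * k : ℝ)) =
      2 ^ (-(n / p * (1 - p / p₀) * k)) := by
    rw [← two_rpow_add]; congr 1; field_simp; ring
  have e5 : (1 - 2 * (n * (1 / 2 - 1)) : ℝ) = 1 + n := by ring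
  rw [e5, ← e3, ← e4]
  refine add_le_add ?_ ?_
  · calc _ = 2 ^ (1 + n : ℝ) * (2 ^ (-((n / p - n / 2) * k)) * 2 ^ (-(n * (1 / 2 - 1) * k : ℝ)) *
        ∫⁻ x, (if 2 ^ (n / p * k) < ‖f x‖ₑ then ‖f x‖ₑ else 0)) := by ring
      _ ≤ _ := mul_le_mul_left le_self_add _
  · calc _ = 2 ^ (1 - 2 * (n * (1 / 2 - 1 / p₀))) * τ * (2 ^ (-((n / p - n / 2) * k)) *
        2 ^ (-(n * (1 / 2 - 1 / p₀) * k : ℝ)) *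
        (∫⁻ x, (if 2 ^ (n / p * k) < ‖f x‖ₑ then 0 else ‖f x‖ₑ) ^ p₀) ^ (1 / p₀)) := by ring
      _ ≤ _ := mul_le_mul_left le_add_self _

lemma exists_gaussNorm_le_of_lt {p p₀ : ℝ} (hn : 0 < n) (hp : 1 < p) (hpp : p < p₀)
    {τ : ℝ≥0∞} (hτ' : τ ≠ ∞) (hτ : HasGaussType X p₀ τ) :
    ∃ C : ℝ≥0∞, C ≠ ∞ ∧ ∀ {ι : Type} [Fintype ι] (E : ι → Set (EuclideanSpace ℝ (Fin n)))
      (b : ι → ℤ) (f : EuclideanSpace ℝ (Fin n) → X), (∀ i, MeasurableSet (E i)) →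
      Pairwise (Function.onFun Disjoint E) → (∀ i, E i ⊆ annulus n (b i)) →
      Integrable f → StronglyMeasurable f → ∫⁻ x, ‖f x‖ₑ ^ p ≤ 1 →
      gaussNorm (fun i => (2 : ℝ) ^ (-((n / p - n / 2) * b i)) • ∫ x, cellKernel (E i) x • f x)
        ≤ C := by
  obtain ⟨C, hC, h⟩ := sum_truncation_rpow_le (ρ := n / p) (by positivity) hp hpp
  have hp₀ : 0 < p₀ := by linarith
  set M : ℝ≥0∞ := 2 ^ (1 + n : ℝ) + 2 ^ (1 - 2 * (n * (1 / 2 - 1 / p₀))) * τ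
  have hM : M ≠ ∞ := ENNReal.add_ne_top.2
    ⟨two_rpow_ne_top _, ENNReal.mul_ne_top (two_rpow_ne_top _) hτ'⟩
  refine ⟨τ * (M ^ p₀ * C) ^ (1 / p₀), ENNReal.mul_ne_top hτ'
    (ENNReal.rpow_ne_top_of_nonneg (by positivity) (ENNReal.mul_ne_top
      (ENNReal.rpow_ne_top_of_nonneg hp₀.le hM) hC)), ?_⟩
  intro ι _ E b f hE hd hEa hf hfm hfp
  classical
  set S := Finset.univ.image b
  have h1 := hτ (fun i => (⟨b i, Finset.mem_image_of_mem _ (Finset.mem_univ i)⟩ : S))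
    (fun i => (2 : ℝ) ^ (-((n / p - n / 2) * b i)) • ∫ x, cellKernel (E i) x • f x)
  refine h1.trans ?_
  gcongr
  simp only [Subtype.ext_iff]
  rw [Finset.sum_coe_sort S fun k => gaussNorm (fun i => if b i = k then
        (2 : ℝ) ^ (-((n / p - n / 2) * b i)) • ∫ x, cellKernel (E i) x • f x else 0) ^ p₀]
  refine (Finset.sum_le_sum fun k _ => ENNReal.rpow_le_rpow
    (gaussNorm_block_le_truncation hE hd hEa (by linarith) (by linarith) hτ' hτ hf hfm k)
    hp₀.le).trans ?_
  simp only [ENNReal.mul_rpow_of_nonneg _ _ hp₀.le, ← Finset.mul_sum]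
  gcongr
  exact h volume (fun x => ‖f x‖ₑ) S hfm.enorm hfp

/-- The gaussian norm of the weighted cell coefficients of `f` is controlled by its `L^p` norm. -/
lemma exists_gaussNorm_le {p p₀ : ℝ} (hn : 0 < n) (hp : 1 < p)
    (hpp : p < p₀ ∨ (p = p₀ ∧ p₀ = 2)) {τ : ℝ≥0∞} (hτ' : τ ≠ ∞) (hτ : HasGaussType X p₀ τ) :
    ∃ C : ℝ≥0∞, C ≠ ∞ ∧ ∀ {ι : Type} [Fintype ι] (E : ι → Set (EuclideanSpace ℝ (Fin n)))
      (b : ι → ℤ) (f : EuclideanSpace ℝ (Fin n) → X), (∀ i, MeasurableSet (E i)) →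
      Pairwise (Function.onFun Disjoint E) → (∀ i, E i ⊆ annulus n (b i)) →
      Integrable f → StronglyMeasurable f → ∫⁻ x, ‖f x‖ₑ ^ p ≠ ∞ →
      gaussNorm (fun i => (2 : ℝ) ^ (-((n / p - n / 2) * b i)) • ∫ x, cellKernel (E i) x • f x)
        ≤ C * (∫⁻ x, ‖f x‖ₑ ^ p) ^ (1 / p) := by
  have hp0 : 0 < p := by linarith
  rcases hpp with hpp | ⟨rfl, rfl⟩
  · obtain ⟨C, hC, h⟩ := exists_gaussNorm_le_of_lt (n := n) (X := X) hn hp hpp hτ' hτ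
    refine ⟨C, hC, fun E b f hE hd hEa hf hfm hfp => ?_⟩
    refine le_mul_of_forall_scaling hC (ENNReal.rpow_ne_top_of_nonneg (by positivity) hfp) ?_
    intro c hc hcf
    have h1 := h E b (fun x => c • f x) hE hd hEa (hf.smul c) (hfm.const_smul c) (by
      simp only [enorm_smul, ENNReal.mul_rpow_of_nonneg _ _ hp0.le]
      rw [lintegral_const_mul _ (hfm.enorm.pow_const p), Real.enorm_of_nonneg hc.le]
      have h2 := ENNReal.rpow_le_rpow hcf hp0.le
      rwa [ENNReal.mul_rpow_of_nonneg _ _ hp0.le, ← ENNReal.rpow_mul, one_div,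
        inv_mul_cancel₀ hp0.ne', ENNReal.rpow_one, ENNReal.one_rpow] at h2)
    rw [← Real.enorm_of_nonneg hc.le, ← gaussNorm_smul]
    refine le_trans (le_of_eq ?_) h1
    congr 1
    ext i
    rw [Pi.smul_apply, smul_comm]
    congr 1
    rw [← integral_smul]
    congr 1
    ext x
    rw [smul_comm]
  · refine ⟨2 * τ, ENNReal.mul_ne_top (by simp) hτ', ?_⟩
    intro ι _ E b f hE hd hEa hf hfm hfp
    obtain ⟨K, hK⟩ := (Set.finite_range b).bddAbove
    have h1 := gaussNorm_integral_cellKernel_le (annScale_pos K) hE hd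
      (fun i => (hEa i).trans (annulus_subset_freqCube (hK ⟨i, rfl⟩))) one_le_two hτ'
      (fun J v => hτ.pointwise J v) hf
    simpa using h1

end TypeEstimate

section CotypeEstimate

variable {n : ℕ} {Y : Type*} [NormedAddCommGroup Y] [NormedSpace ℂ Y] [CompleteSpace Y]

lemma sum_cellKernel_cellsAt {Y : Type*} [NormedAddCommGroup Y] [NormedSpace ℂ Y] {ι : Type} [Fintype ι] (E : ι → Set (EuclideanSpace ℝ (Fin n)))
    (b : ι → ℤ) (t : ℝ) (y : ι → Y) (x : EuclideanSpace ℝ (Fin n)) :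
    ∑ i, (2 : ℝ) ^ (-(t * b i)) • cellKernel (E i) x • y i =
      ∑ k ∈ Finset.univ.image b, (2 : ℝ) ^ (-(t * k)) •
        ∑ i, cellKernel (cellsAt E b k i) x • if b i = k then y i else 0 := by
  simp only [Finset.smul_sum]
  rw [Finset.sum_comm]
  refine Finset.sum_congr rfl fun i _ => ?_
  rw [Finset.sum_eq_single_of_mem (b i) (Finset.mem_image_of_mem _ (Finset.mem_univ i))]
  · rw [if_pos rfl, cellsAt_of_eq rfl]
  · intro k _ hk
    rw [if_neg hk.symm, smul_zero, smul_zero]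

lemma gaussNorm_ite_le {ι Y : Type*} [Fintype ι] [NormedAddCommGroup Y] [NormedSpace ℝ Y]
    [CompleteSpace Y] (b : ι → ℤ) (k : ℤ) (y : ι → Y) :
    gaussNorm (fun i => if b i = k then y i else 0) ≤ gaussNorm y := by
  have h1 := gaussNorm_mul_le (a := fun i => if b i = k then 1 else 0)
    (fun i => by split_ifs <;> simp) y
  simpa only [ite_smul, one_smul, zero_smul] using h1

lemma lintegral_rpow_le_of_gaussNorm_le_one {q q₀ : ℝ} {κ C : ℝ≥0∞} (hq0 : 1 < q₀) (hq : q₀ < q)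
    (hκ : HasGaussCotype Y q₀ κ)
    (hC : ∀ (S : Finset ℤ) (b : ℤ → ℝ≥0∞), (∀ k, b k ≤ 2 ^ (n / q * k)) →
      (∑ k ∈ S, b k) ^ q ≤ C * ∑ k ∈ S, 2 ^ (n / q * (q - q₀) * k) * b k ^ q₀)
    {ι : Type} [Fintype ι] {E : ι → Set (EuclideanSpace ℝ (Fin n))} {b : ι → ℤ}
    (hE : ∀ i, MeasurableSet (E i)) (hd : Pairwise (Function.onFun Disjoint E))
    (hEa : ∀ i, E i ⊆ annulus n (b i)) {y : ι → Y} (hy : 2 ^ (1 + n : ℝ) * gaussNorm y ≤ 1) :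
    ∫⁻ x, ‖∑ i, (2 : ℝ) ^ (-((n / 2 - n / q) * b i)) • cellKernel (E i) x • y i‖ₑ ^ q ≤
      C * ((2 ^ (1 - 2 * (n * (1 / q₀ - 1 / 2))) * κ) ^ q₀ * κ ^ q₀) := by
  classical
  have hq₀ : 0 < q₀ := by linarith
  have hqp : 0 < q := by linarith
  set S := Finset.univ.image b
  set e : ℝ := n * (1 / q₀ - 1 / 2) with he
  set t : ℝ := n / 2 - n / q with ht
  set c : ℤ → ℝ≥0∞ := fun k => gaussNorm (fun i => if b i = k then y i else 0) with hc
  set h : ℤ → EuclideanSpace ℝ (Fin n) → Y := fun k x =>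
    ∑ i, cellKernel (cellsAt E b k i) x • if b i = k then y i else 0 with hh
  have hgy : gaussNorm y ≤ 1 := by
    refine le_trans ?_ hy
    refine le_mul_of_one_le_left zero_le ?_
    exact ENNReal.one_le_rpow (by norm_num) (by positivity)
  have hpt (k : ℤ) (x) : 2 ^ (-(t * k)) * ‖h k x‖ₑ ≤ 2 ^ (n / q * k) := by
    have h1 := enorm_sum_cellKernel_le (annScale_pos k) x (measurableSet_cellsAt hE k)
      (pairwise_disjoint_cellsAt hd k) (cellsAt_subset hEa k) (fun i => if b i = k then y i else 0)
    rw [ofReal_two_mul_annScale_rpow] at h1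
    calc 2 ^ (-(t * k)) * ‖h k x‖ₑ
        ≤ 2 ^ (-(t * k)) * (2 ^ (1 - 2 * (-(n / 2 : ℝ))) * 2 ^ (-(-(n / 2 : ℝ) * k)) *
          gaussNorm y) := by
          gcongr
          exact h1.trans (mul_le_mul_right (gaussNorm_ite_le b k y) _)
      _ = 2 ^ (n / q * k) * (2 ^ (1 + n : ℝ) * gaussNorm y) := by
          have e1 : (2 : ℝ≥0∞) ^ (n / q * k) = 2 ^ (-(t * k)) * 2 ^ (-(-(n / 2 : ℝ) * k)) := by
            rw [← two_rpow_add]; congr 1; rw [ht]; ring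
          have e2 : (1 - 2 * (-(n / 2)) : ℝ) = 1 + n := by ring
          rw [e1, e2]; ring
      _ ≤ 2 ^ (n / q * k) * 1 := by gcongr
      _ = _ := mul_one _
  have hmeas (k : ℤ) : Measurable fun x => ‖h k x‖ₑ := by
    refine Continuous.measurable ?_
    refine continuous_enorm.comp (continuous_finsetSum _ fun i _ => ?_)
    refine (continuous_cellKernel _ ?_).smul continuous_const
    exact measure_ne_top_of_subset (cellsAt_subset hEa k i) (volume_freqCube_ne_top _)
  have hint (k : ℤ) : ∫⁻ x, ‖h k x‖ₑ ^ q₀ ≤ (2 ^ (1 - 2 * e) * 2 ^ (-(e * k)) * κ * c k) ^ q₀ := by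
    have h1 := lintegral_sum_cellKernel_rpow_le (annScale_pos k) (measurableSet_cellsAt hE k)
      (pairwise_disjoint_cellsAt hd k) (cellsAt_subset hEa k) hq₀ (fun J v => hκ.pointwise J v)
      (fun i => if b i = k then y i else 0)
    rwa [ofReal_two_mul_annScale_rpow, one_div (q₀ : ℝ), ENNReal.rpow_inv_le_iff hq₀,
      ← one_div] at h1
  calc ∫⁻ x, ‖∑ i, (2 : ℝ) ^ (-(t * b i)) • cellKernel (E i) x • y i‖ₑ ^ q
      ≤ ∫⁻ x, C * ∑ k ∈ S, 2 ^ (n / q * (q - q₀) * k) * (2 ^ (-(t * k)) * ‖h k x‖ₑ) ^ q₀ := by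
        refine lintegral_mono fun x => ?_
        refine le_trans ?_ (hC S (fun k => 2 ^ (-(t * k)) * ‖h k x‖ₑ) fun k => hpt k x)
        gcongr
        rw [sum_cellKernel_cellsAt]
        refine (enorm_sum_le _ _).trans_eq (Finset.sum_congr rfl fun k _ => ?_)
        rw [enorm_smul, Real.enorm_of_nonneg (by positivity), ofReal_two_rpow]
    _ = C * ∑ k ∈ S, 2 ^ (n / q * (q - q₀) * k) * ((2 ^ (-(t * k))) ^ q₀ *
          ∫⁻ x, ‖h k x‖ₑ ^ q₀) := by
        simp only [ENNReal.mul_rpow_of_nonneg _ _ hq₀.le]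
        have hm (k : ℤ) : Measurable fun x => ‖h k x‖ₑ ^ q₀ := (hmeas k).pow_const _
        rw [lintegral_const_mul _ (Finset.measurable_sum _ fun k _ =>
          ((hm k).const_mul _).const_mul _), lintegral_finsetSum _ fun k _ =>
          ((hm k).const_mul _).const_mul _]
        congr 1
        refine Finset.sum_congr rfl fun k _ => ?_
        rw [lintegral_const_mul _ ((hm k).const_mul _), lintegral_const_mul _ (hm k)]
    _ ≤ C * ∑ k ∈ S, (2 ^ (1 - 2 * e) * κ) ^ q₀ * c k ^ q₀ := by
        refine mul_le_mul_right (Finset.sum_le_sum fun k _ => ?_) _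
        refine (mul_le_mul_right (mul_le_mul_right (hint k) _) _).trans_eq ?_
        rw [← ENNReal.rpow_mul, mul_right_comm _ _ κ, mul_right_comm _ _ (c k),
          ENNReal.mul_rpow_of_nonneg _ ((2 : ℝ≥0∞) ^ (-(e * k))) hq₀.le, ← ENNReal.rpow_mul,
          ENNReal.mul_rpow_of_nonneg _ (c k) hq₀.le]
        have e1 : (2 : ℝ≥0∞) ^ (n / q * (q - q₀) * k) * (2 ^ (-(t * k) * q₀) *
            2 ^ (-(e * k) * q₀)) = 1 := by
          rw [← two_rpow_add, ← two_rpow_add, ← ENNReal.rpow_zero (x := 2)]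
          congr 1
          rw [he, ht]; field_simp; ring
        calc _ = (2 : ℝ≥0∞) ^ (n / q * (q - q₀) * k) * (2 ^ (-(t * k) * q₀) *
            2 ^ (-(e * k) * q₀)) * ((2 ^ (1 - 2 * e) * κ) ^ q₀ * c k ^ q₀) := by ring
          _ = _ := by rw [e1, one_mul]
    _ = C * ((2 ^ (1 - 2 * e) * κ) ^ q₀ * ∑ k ∈ S, c k ^ q₀) := by rw [← Finset.mul_sum]
    _ ≤ _ := by
        gcongr
        have h1 := hκ (fun i => (⟨b i, Finset.mem_image_of_mem _ (Finset.mem_univ i)⟩ : S)) y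
        simp only [Subtype.ext_iff] at h1
        rw [Finset.sum_coe_sort S fun k => c k ^ q₀, one_div, ENNReal.rpow_inv_le_iff hq₀] at h1
        refine h1.trans (ENNReal.rpow_le_rpow ?_ hq₀.le)
        exact (mul_le_mul_right hgy _).trans_eq (mul_one _)

/-- The `L^q` norm of a weighted combination of cell kernels is controlled by the gaussian norm of
its coefficients. -/
lemma exists_lintegral_rpow_le {q q₀ : ℝ} (hn : 0 < n) (hq₀ : 2 ≤ q₀)
    (hq : q₀ < q ∨ (q = q₀ ∧ q₀ = 2)) {κ : ℝ≥0∞} (hκ' : κ ≠ ∞) (hκ : HasGaussCotype Y q₀ κ) :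
    ∃ C : ℝ≥0∞, C ≠ ∞ ∧ ∀ {ι : Type} [Fintype ι] (E : ι → Set (EuclideanSpace ℝ (Fin n)))
      (b : ι → ℤ) (y : ι → Y), (∀ i, MeasurableSet (E i)) →
      Pairwise (Function.onFun Disjoint E) → (∀ i, E i ⊆ annulus n (b i)) →
      (∫⁻ x, ‖∑ i, (2 : ℝ) ^ (-((n / 2 - n / q) * b i)) • cellKernel (E i) x • y i‖ₑ ^ q) ^ (1 / q)
        ≤ C * gaussNorm y := by
  rcases hq with hq | ⟨rfl, rfl⟩
  · have hqp : 0 < q := by linarith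
    obtain ⟨C, hC, h⟩ := rpow_sum_le_sum_rpow (η := n / q) (by positivity)
      (show 1 < q₀ by linarith) hq
    set D : ℝ≥0∞ := C * ((2 ^ (1 - 2 * (n * (1 / q₀ - 1 / 2))) * κ) ^ q₀ * κ ^ q₀) with hD
    have hDt : D ≠ ∞ := by
      refine ENNReal.mul_ne_top hC (ENNReal.mul_ne_top ?_ ?_) <;>
        refine ENNReal.rpow_ne_top_of_nonneg (by linarith) ?_
      · exact ENNReal.mul_ne_top (two_rpow_ne_top _) hκ'
      · exact hκ'
    have hDq : D ^ (1 / q) ≠ ∞ := ENNReal.rpow_ne_top_of_nonneg (by positivity) hDt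
    refine ⟨D ^ (1 / q) * 2 ^ (1 + n : ℝ), ENNReal.mul_ne_top hDq (two_rpow_ne_top _), ?_⟩
    intro ι _ E b y hE hd hEa
    rw [mul_assoc]
    refine le_mul_of_forall_scaling hDq
      (ENNReal.mul_ne_top (two_rpow_ne_top _) (gaussNorm_ne_top _)) fun c hc hcy => ?_
    have h1 := lintegral_rpow_le_of_gaussNorm_le_one (by linarith) hq hκ h hE hd hEa (y := c • y)
      (by rwa [gaussNorm_smul, Real.enorm_of_nonneg hc.le, mul_left_comm])
    refine le_trans (le_of_eq ?_) (ENNReal.rpow_le_rpow h1 (show 0 ≤ 1 / q by positivity))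
    have h2 (x) : ∑ i, (2 : ℝ) ^ (-((n / 2 - n / q) * b i)) • cellKernel (E i) x • (c • y) i =
        c • ∑ i, (2 : ℝ) ^ (-((n / 2 - n / q) * b i)) • cellKernel (E i) x • y i := by
      rw [Finset.smul_sum]
      refine Finset.sum_congr rfl fun i _ => ?_
      rw [Pi.smul_apply, smul_comm _ c, smul_comm _ c]
    simp only [h2, enorm_smul, ENNReal.mul_rpow_of_nonneg _ _ hqp.le]
    rw [lintegral_const_mul', ENNReal.mul_rpow_of_nonneg _ _ (by positivity), ← ENNReal.rpow_mul,
      mul_one_div_cancel hqp.ne', ENNReal.rpow_one, Real.enorm_of_nonneg hc.le]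
    exact ENNReal.rpow_ne_top_of_nonneg hqp.le (by simp)
  · refine ⟨2 * κ, ENNReal.mul_ne_top (by simp) hκ', ?_⟩
    intro ι _ E b y hE hd hEa
    obtain ⟨K, hK⟩ := (Set.finite_range b).bddAbove
    have h1 := lintegral_sum_cellKernel_rpow_le (annScale_pos K) hE hd
      (fun i => (hEa i).trans (annulus_subset_freqCube (hK ⟨i, rfl⟩))) two_pos
      (fun J v => hκ.pointwise J v) y
    simpa using h1

end CotypeEstimate

section RBounded

variable {n : ℕ} {X Y : Type*} [NormedAddCommGroup X] [NormedSpace ℂ X] [CompleteSpace X]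
  [NormedAddCommGroup Y] [NormedSpace ℂ Y] [CompleteSpace Y]
  {m : EuclideanSpace ℝ (Fin n) → (X →L[ℂ] Y)} {ρ a : ℝ}

lemma gaussNorm_symbol_le (hρ : 0 ≤ ρ)
    (hR : ∀ (N : ℕ) (ξ : Fin N → EuclideanSpace ℝ (Fin n)) (_ : ∀ i, ξ i ≠ 0) (x : Fin N → X),
      Real.sqrt (radAvg N fun ε => ‖∑ i, radSign (ε i) • ((‖ξ i‖ ^ a) • m (ξ i)) (x i)‖ ^ 2) ≤
        ρ * Real.sqrt (radAvg N fun ε => ‖∑ i, radSign (ε i) • x i‖ ^ 2))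
    {ι : Type*} [Fintype ι] {ξ : ι → EuclideanSpace ℝ (Fin n)} (hξ : ∀ i, ξ i ≠ 0) (x : ι → X) :
    gaussNorm (fun i => ‖ξ i‖ ^ a • m (ξ i) (x i)) ≤ ENNReal.ofReal ρ * gaussNorm x := by
  set e := Fintype.equivFin ι
  have h1 := gaussNorm_le_of_rBounded hρ
    (T := fun j v => ((‖ξ (e.symm j)‖ ^ a) • m (ξ (e.symm j))) v)
    (fun j c v => ContinuousLinearMap.map_smul_of_tower _ c v)
    (hR _ (fun j => ξ (e.symm j)) fun j => hξ _) e x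
  simpa using h1

lemma norm_symbol_apply_le (hρ : 0 ≤ ρ)
    (hR : ∀ (N : ℕ) (ξ : Fin N → EuclideanSpace ℝ (Fin n)) (_ : ∀ i, ξ i ≠ 0) (x : Fin N → X),
      Real.sqrt (radAvg N fun ε => ‖∑ i, radSign (ε i) • ((‖ξ i‖ ^ a) • m (ξ i)) (x i)‖ ^ 2) ≤
        ρ * Real.sqrt (radAvg N fun ε => ‖∑ i, radSign (ε i) • x i‖ ^ 2))
    {ξ : EuclideanSpace ℝ (Fin n)} (hξ : ξ ≠ 0) (x : X) :
    ‖m ξ x‖ ≤ ρ * ‖ξ‖ ^ (-a) * ‖x‖ := by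
  have h1 := gaussNorm_symbol_le hρ hR (ξ := fun _ : Unit => ξ) (fun _ => hξ) fun _ => x
  have hpos : 0 < ‖ξ‖ ^ a := Real.rpow_pos_of_pos (norm_pos_iff.2 hξ) _
  rw [gaussNorm_unique, gaussNorm_unique, enorm_smul, Real.enorm_of_nonneg hpos.le,
    ← ofReal_norm, ← ofReal_norm, ← ENNReal.ofReal_mul hpos.le, ← ENNReal.ofReal_mul hρ,
    ENNReal.ofReal_le_ofReal_iff (by positivity)] at h1
  rw [Real.rpow_neg (norm_nonneg _), mul_right_comm, ← div_eq_mul_inv, le_div_iff₀ hpos, mul_comm]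
  exact h1

lemma norm_symbol_apply_le_of_mem_annulus (hρ : 0 ≤ ρ) (ha : 0 ≤ a)
    (hR : ∀ (N : ℕ) (ξ : Fin N → EuclideanSpace ℝ (Fin n)) (_ : ∀ i, ξ i ≠ 0) (x : Fin N → X),
      Real.sqrt (radAvg N fun ε => ‖∑ i, radSign (ε i) • ((‖ξ i‖ ^ a) • m (ξ i)) (x i)‖ ^ 2) ≤
        ρ * Real.sqrt (radAvg N fun ε => ‖∑ i, radSign (ε i) • x i‖ ^ 2))
    {k : ℤ} {ξ : EuclideanSpace ℝ (Fin n)} (hξ : ξ ∈ annulus n k) (x : X) :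
    ‖m ξ x‖ ≤ ρ * (2 : ℝ) ^ (-(a * k)) * ‖x‖ := by
  have h0 : ξ ≠ 0 := norm_pos_iff.1 (lt_of_lt_of_le (by positivity) hξ.1)
  refine (norm_symbol_apply_le hρ hR h0 x).trans ?_
  gcongr
  have e1 : (2 : ℝ) ^ (-(a * k)) = ((2 : ℝ) ^ (k : ℝ)) ^ (-a) := by
    rw [← Real.rpow_mul (by norm_num)]; congr 1; ring
  rw [e1]
  exact Real.rpow_le_rpow_of_nonpos (by positivity) hξ.1 (by linarith)

lemma ne_zero_of_mem_annulus {k : ℤ} {ξ : EuclideanSpace ℝ (Fin n)} (hξ : ξ ∈ annulus n k) :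
    ξ ≠ 0 := norm_pos_iff.1 (lt_of_lt_of_le (by positivity) hξ.1)

lemma gaussNorm_symbol_average_le {s t : ℝ} (hρ : 0 ≤ ρ) (ha : 0 ≤ a) (hst : s + t = a)
    (hm : ∀ x : X, StronglyMeasurable (fun ξ => m ξ x))
    (hR : ∀ (N : ℕ) (ξ : Fin N → EuclideanSpace ℝ (Fin n)) (_ : ∀ i, ξ i ≠ 0) (x : Fin N → X),
      Real.sqrt (radAvg N fun ε => ‖∑ i, radSign (ε i) • ((‖ξ i‖ ^ a) • m (ξ i)) (x i)‖ ^ 2) ≤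
        ρ * Real.sqrt (radAvg N fun ε => ‖∑ i, radSign (ε i) • x i‖ ^ 2))
    {ι : Type} [Fintype ι] {E : ι → Set (EuclideanSpace ℝ (Fin n))} {b : ι → ℤ}
    (hE : ∀ i, MeasurableSet (E i)) (hE0 : ∀ i, volume (E i) ≠ 0)
    (hEa : ∀ i, E i ⊆ annulus n (b i)) (x : ι → X) :
    gaussNorm (fun i => (2 : ℝ) ^ (t * b i) •
        ∫ ξ, m ξ (x i) ∂(ProbabilityTheory.cond volume (E i))) ≤
      ENNReal.ofReal ρ * gaussNorm (fun i => (2 : ℝ) ^ (-(s * b i)) • x i) := by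
  set μ : ι → Measure (EuclideanSpace ℝ (Fin n)) := fun i => ProbabilityTheory.cond volume (E i)
  have hμ (i : ι) : IsProbabilityMeasure (μ i) :=
    cond_isProbabilityMeasure_of_finite (hE0 i) (volume_ne_top_of_subset_annulus (hEa i))
  set F : (ι → EuclideanSpace ℝ (Fin n)) → ι → Y := fun ω i =>
    (2 : ℝ) ^ (t * b i) • m (ω i) (x i)
  have hint (i : ι) : Integrable (fun ξ => (2 : ℝ) ^ (t * b i) • m ξ (x i)) (μ i) := by
    refine Integrable.smul _ ?_
    refine Integrable.of_bound (hm _).aestronglyMeasurable _ ((ae_cond_mem (hE i)).mono fun ξ hξ =>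
      norm_symbol_apply_le_of_mem_annulus hρ ha hR (hEa i hξ) (x i))
  have hF (i : ι) : Integrable (F · i) (Measure.pi μ) :=
    integrable_comp_eval (μ := μ) (f := fun ξ => (2 : ℝ) ^ (t * b i) • m ξ (x i)) (hint i)
  have hmean : (fun i => (2 : ℝ) ^ (t * b i) • ∫ ξ, m ξ (x i) ∂μ i) = ∫ ω, F ω ∂Measure.pi μ := by
    ext i
    rw [eval_integral hF, ← integral_smul]
    exact (integral_comp_eval (μ := μ) (hint i).aestronglyMeasurable).symm
  rw [hmean]
  refine (gaussNorm_integral_le (Integrable.of_eval hF)).trans ?_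
  have hae : ∀ᵐ ω ∂Measure.pi μ, ∀ i, ω i ∈ E i := ae_all_iff.2 fun i =>
    (measurePreserving_eval μ i).quasiMeasurePreserving.ae (ae_cond_mem (hE i))
  refine (lintegral_mono_ae (g := fun _ => ENNReal.ofReal ρ *
    gaussNorm (fun i => (2 : ℝ) ^ (-(s * b i)) • x i)) (hae.mono fun ω hω => ?_)).trans_eq (by simp)
  have hω0 (i : ι) : 0 < ‖ω i‖ := norm_pos_iff.2 (ne_zero_of_mem_annulus (hEa i (hω i)))
  refine le_trans ?_ (gaussNorm_symbol_le hρ hR (fun i => ne_zero_of_mem_annulus (hEa i (hω i))) _)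
  have h1 : F ω = fun i => (((2 : ℝ) ^ (b i : ℝ)) ^ a / ‖ω i‖ ^ a) •
      (‖ω i‖ ^ a • m (ω i) ((2 : ℝ) ^ (-(s * b i)) • x i)) := by
    ext i
    change (2 : ℝ) ^ (t * b i) • m (ω i) (x i) = _
    rw [ContinuousLinearMap.map_smul_of_tower, smul_smul, smul_smul,
      div_mul_cancel₀ _ (Real.rpow_pos_of_pos (hω0 i) _).ne', ← Real.rpow_mul (by norm_num),
      ← Real.rpow_add (by norm_num)]
    congr 2
    rw [← hst]; ring
  rw [h1]
  refine gaussNorm_mul_le (fun i => ?_) _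
  have h2 : 0 < ‖ω i‖ ^ a := Real.rpow_pos_of_pos (hω0 i) _
  rw [abs_of_nonneg (by positivity), div_le_one h2]
  exact Real.rpow_le_rpow (by positivity) (hEa i (hω i)).1 ha

end RBounded

section Discrete

variable {n : ℕ} {X Y : Type*} [NormedAddCommGroup X] [NormedSpace ℂ X] [CompleteSpace X]
  [NormedAddCommGroup Y] [NormedSpace ℂ Y] [CompleteSpace Y]
  {m : EuclideanSpace ℝ (Fin n) → (X →L[ℂ] Y)} {ρ : ℝ}

/-- The discretisation over the cells `E i` of the multiplier operator with symbol `m`. -/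
noncomputable def cellOperator {ι : Type} [Fintype ι] (m : EuclideanSpace ℝ (Fin n) → (X →L[ℂ] Y))
    (E : ι → Set (EuclideanSpace ℝ (Fin n))) (f : EuclideanSpace ℝ (Fin n) → X)
    (x : EuclideanSpace ℝ (Fin n)) : Y :=
  ∑ i, cellKernel (E i) (-x) •
    ∫ ξ, m ξ (∫ z, cellKernel (E i) z • f z) ∂(ProbabilityTheory.cond volume (E i))

lemma eLpNorm_ofReal_eq {α F : Type*} [MeasurableSpace α] [NormedAddCommGroup F] {μ : Measure α}
    (f : α → F) {p : ℝ} (hp : 0 < p) :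
    eLpNorm f (ENNReal.ofReal p) μ = (∫⁻ x, ‖f x‖ₑ ^ p ∂μ) ^ (1 / p) := by
  rw [eLpNorm_eq_lintegral_rpow_enorm_toReal (by simpa using hp) (by simp),
    ENNReal.toReal_ofReal hp.le]

lemma exists_eLpNorm_cellOperator_le {p₀ q₀ p q : ℝ} (hn : 0 < n) (hp₀2 : p₀ ≤ 2) (hq₀ : 2 ≤ q₀)
    (hp : 1 < p) (hp' : p < p₀ ∨ (p = p₀ ∧ p₀ = 2)) (hq' : q₀ < q ∨ (q = q₀ ∧ q₀ = 2))
    {τ κ : ℝ≥0∞} (hτ' : τ ≠ ∞) (hτ : HasGaussType X p₀ τ) (hκ' : κ ≠ ∞)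
    (hκ : HasGaussCotype Y q₀ κ) (hρ : 0 ≤ ρ)
    (hm : ∀ x : X, StronglyMeasurable (fun ξ => m ξ x))
    (hR : ∀ (N : ℕ) (ξ : Fin N → EuclideanSpace ℝ (Fin n)) (_ : ∀ i, ξ i ≠ 0) (x : Fin N → X),
      Real.sqrt (radAvg N fun ε => ‖∑ i, radSign (ε i) •
        ((‖ξ i‖ ^ ((n : ℝ) * (1 / p - 1 / q))) • m (ξ i)) (x i)‖ ^ 2) ≤
        ρ * Real.sqrt (radAvg N fun ε => ‖∑ i, radSign (ε i) • x i‖ ^ 2)) :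
    ∃ C : ℝ≥0∞, C ≠ ∞ ∧ ∀ {ι : Type} [Fintype ι] (E : ι → Set (EuclideanSpace ℝ (Fin n)))
      (b : ι → ℤ) (f : EuclideanSpace ℝ (Fin n) → X), (∀ i, MeasurableSet (E i)) →
      Pairwise (Function.onFun Disjoint E) → (∀ i, volume (E i) ≠ 0) →
      (∀ i, E i ⊆ annulus n (b i)) →
      Integrable f → StronglyMeasurable f → eLpNorm f (ENNReal.ofReal p) volume ≠ ∞ →
      eLpNorm (cellOperator m E f) (ENNReal.ofReal q) volume ≤
        C * eLpNorm f (ENNReal.ofReal p) volume := by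
  have hp0 : 0 < p := by linarith
  have hq2 : 2 ≤ q := by rcases hq' with h | ⟨h, -⟩ <;> linarith
  have hp2 : p ≤ 2 := by rcases hp' with h | ⟨h, -⟩ <;> linarith
  have hq0 : 0 < q := by linarith
  obtain ⟨C₁, hC₁, h₁⟩ := exists_gaussNorm_le (n := n) (X := X) hn hp hp' hτ' hτ
  obtain ⟨C₂, hC₂, h₂⟩ := exists_lintegral_rpow_le (n := n) (Y := Y) hn hq₀ hq' hκ' hκ
  refine ⟨C₂ * (ENNReal.ofReal ρ * C₁), ENNReal.mul_ne_top hC₂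
    (ENNReal.mul_ne_top (by simp) hC₁), ?_⟩
  intro ι _ E b f hE hd hE0 hEa hf hfm hfp
  have ha : 0 ≤ (n : ℝ) * (1 / p - 1 / q) := by
    have : 1 / q ≤ 1 / p := one_div_le_one_div_of_le hp0 (hp2.trans hq2)
    exact mul_nonneg (by positivity) (by linarith)
  rw [eLpNorm_ofReal_eq f hp0] at hfp ⊢
  rw [eLpNorm_ofReal_eq _ hq0]
  have hfp' : ∫⁻ x, ‖f x‖ₑ ^ p ≠ ∞ := fun h => hfp (by rw [h, ENNReal.top_rpow_of_pos (by positivity)])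
  have k1 := h₁ E b f hE hd hEa hf hfm hfp'
  have k2 := gaussNorm_symbol_average_le (s := n / p - n / 2) (t := n / 2 - n / q) hρ ha (by ring)
    hm hR hE hE0 hEa (fun i => ∫ z, cellKernel (E i) z • f z)
  have k3 := h₂ E b (fun i => (2 : ℝ) ^ ((n / 2 - n / q) * b i) •
        ∫ ξ, m ξ (∫ z, cellKernel (E i) z • f z) ∂(ProbabilityTheory.cond volume (E i))) hE hd hEa
  refine le_trans (le_of_eq ?_) (k3.trans (((mul_le_mul_right (k2.trans
    (mul_le_mul_right k1 _)) _)).trans_eq (by ring)))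
  congr 1
  rw [← lintegral_neg_eq_self]
  refine lintegral_congr fun x => ?_
  congr 2
  rw [cellOperator]
  refine Finset.sum_congr rfl fun i _ => ?_
  rw [neg_neg, smul_comm (cellKernel (E i) x), smul_smul, ← Real.rpow_add (by norm_num),
    neg_add_cancel, Real.rpow_zero, one_smul]

lemma integral_cellKernel_smul {E : Set (EuclideanSpace ℝ (Fin n))} (hE : MeasurableSet E)
    (hE' : volume E ≠ ∞) {f : EuclideanSpace ℝ (Fin n) → X} (hf : Integrable f) :
    ∫ x, cellKernel E x • f x = (√(volume.real E))⁻¹ • ∫ ξ in E, 𝓕 f ξ := by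
  have h1 := VectorFourier.integral_fourierIntegral_smul_eq_flip (L := innerₗ (EuclideanSpace ℝ (Fin n)))
    (μ := volume) (ν := volume) (f := E.indicator fun _ => (1 : ℂ)) (g := f)
    Real.continuous_fourierChar continuous_inner
    ((integrable_indicator_iff hE).2 (integrableOn_const hE')) hf
  have h2 (x : EuclideanSpace ℝ (Fin n)) : VectorFourier.fourierIntegral Real.fourierChar volume
      (innerₗ (EuclideanSpace ℝ (Fin n))) (E.indicator fun _ => (1 : ℂ)) x =
      ∫ ξ in E, (Real.fourierChar (-(inner ℝ ξ x)) : ℂ) := by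
    rw [VectorFourier.fourierIntegral, ← integral_indicator hE]
    congr 1
    ext ξ
    by_cases h : ξ ∈ E <;> simp [h, Circle.smul_def]
  simp only [h2] at h1
  have h3 : ∫ ξ, (E.indicator (fun _ => (1 : ℂ)) ξ) • VectorFourier.fourierIntegral
      Real.fourierChar volume (innerₗ (EuclideanSpace ℝ (Fin n))).flip f ξ = ∫ ξ in E, 𝓕 f ξ := by
    rw [← integral_indicator hE]
    congr 1
    ext ξ
    by_cases h : ξ ∈ E
    · simp only [h, Set.indicator_of_mem, one_smul, flip_innerₗ]
      rfl
    · simp [h]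
  rw [h3] at h1
  rw [← h1, ← integral_smul]
  congr 1
  ext x
  rw [cellKernel, mul_smul, Complex.coe_smul]

end Discrete

section Cells

variable {n : ℕ}

/-- The union of the dyadic annuli with index in `[-K, K]`. -/
def band (n : ℕ) (K : ℕ) : Set (EuclideanSpace ℝ (Fin n)) :=
  ⋃ k ∈ Finset.Icc (-K : ℤ) K, annulus n k

lemma measurableSet_annulus (k : ℤ) : MeasurableSet (annulus n k) :=
  (measurableSet_le measurable_const measurable_norm).inter
    (measurableSet_lt measurable_norm measurable_const)

lemma disjoint_annulus {k l : ℤ} (h : k ≠ l) : Disjoint (annulus n k) (annulus n l) := by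
  wlog hkl : k < l generalizing k l
  · exact (this h.symm (lt_of_le_of_ne (not_lt.1 hkl) h.symm)).symm
  refine Set.disjoint_left.2 fun ξ h1 h2 => absurd (h1.2.trans_le ?_) (lt_irrefl ‖ξ‖)
  refine le_trans (Real.rpow_le_rpow_of_exponent_le (by norm_num) ?_) h2.1
  exact_mod_cast Int.add_one_le_of_lt hkl

lemma measurableSet_band (K : ℕ) : MeasurableSet (band n K) :=
  Finset.measurableSet_biUnion _ fun k _ => measurableSet_annulus k

lemma band_subset_closedBall (K : ℕ) :
    band n K ⊆ Metric.closedBall 0 ((2 : ℝ) ^ (K + 1 : ℝ)) := by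
  intro ξ hξ
  simp only [band, Set.mem_iUnion, Finset.mem_Icc] at hξ
  obtain ⟨k, hk, hξ⟩ := hξ
  rw [mem_closedBall_zero_iff]
  refine hξ.2.le.trans (Real.rpow_le_rpow_of_exponent_le (by norm_num) ?_)
  have : (k : ℝ) ≤ K := by exact_mod_cast hk.2
  linarith

lemma volume_band_ne_top (K : ℕ) : volume (band n K) ≠ ∞ :=
  measure_ne_top_of_subset (band_subset_closedBall K) measure_closedBall_lt_top.ne

lemma monotone_band : Monotone (band n) := by
  intro K L h
  refine Set.biUnion_subset_biUnion_left fun k hk => ?_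
  simp only [Finset.coe_Icc, Set.mem_Icc] at hk ⊢
  omega

lemma exists_mem_band {ξ : EuclideanSpace ℝ (Fin n)} (hξ : ξ ≠ 0) : ∃ K, ξ ∈ band n K := by
  obtain ⟨k, hk⟩ := exists_mem_Ico_zpow (norm_pos_iff.2 hξ) (one_lt_two (α := ℝ))
  refine ⟨k.natAbs, Set.mem_iUnion₂.2 ⟨k, Finset.mem_Icc.2 (by omega), ?_⟩⟩
  refine ⟨?_, ?_⟩
  · rw [Real.rpow_intCast]; exact hk.1
  · have := hk.2
    rw [← Real.rpow_intCast] at this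
    exact_mod_cast this

/-- A simple function which is close to the identity on a compact set. -/
lemma exists_simpleFunc_dist_lt {s : Set (EuclideanSpace ℝ (Fin n))} (hs : IsCompact s) {ε : ℝ}
    (hε : 0 < ε) : ∃ g : SimpleFunc (EuclideanSpace ℝ (Fin n)) (EuclideanSpace ℝ (Fin n)),
      ∀ ξ ∈ s, dist (g ξ) ξ < ε := by
  set e := TopologicalSpace.denseSeq (EuclideanSpace ℝ (Fin n))
  obtain ⟨t, ht⟩ := hs.elim_finite_subcover (fun k => Metric.ball (e k) ε)
    (fun k => Metric.isOpen_ball) fun ξ _ => by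
      obtain ⟨k, hk⟩ := (TopologicalSpace.denseRange_denseSeq _).exists_dist_lt ξ hε
      exact Set.mem_iUnion.2 ⟨k, hk⟩
  refine ⟨SimpleFunc.nearestPt e (t.sup id), fun ξ hξ => ?_⟩
  obtain ⟨k, hk, hξk⟩ := Set.mem_iUnion₂.1 (ht hξ)
  have h1 := SimpleFunc.edist_nearestPt_le e ξ (Finset.le_sup (f := id) hk)
  rw [edist_dist, edist_dist, ENNReal.ofReal_le_ofReal_iff dist_nonneg] at h1
  exact h1.trans_lt (by rw [dist_comm]; exact hξk)

/-- A finite partition, up to a null set, of a band into cells of small diameter. -/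
lemma exists_cells (K : ℕ) {ε : ℝ} (hε : 0 < ε) :
    ∃ (ι : Type) (_ : Fintype ι) (E : ι → Set (EuclideanSpace ℝ (Fin n))) (b : ι → ℤ),
      (∀ i, MeasurableSet (E i)) ∧ Pairwise (Function.onFun Disjoint E) ∧
      (∀ i, volume (E i) ≠ 0) ∧ (∀ i, E i ⊆ annulus n (b i)) ∧ (∀ i, E i ⊆ band n K) ∧
      (∀ i, ∀ ξ ∈ E i, ∀ η ∈ E i, dist ξ η < ε) ∧ ⋃ i, E i =ᵐ[volume] band n K := by
  classical
  obtain ⟨g, hg⟩ := exists_simpleFunc_dist_lt (n := n)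
    (isCompact_closedBall 0 ((2 : ℝ) ^ (K + 1 : ℝ))) (half_pos hε)
  set A : g.range × Finset.Icc (-K : ℤ) K → Set (EuclideanSpace ℝ (Fin n)) := fun i =>
    g ⁻¹' {i.1.1} ∩ annulus n i.2.1 with hA
  have hAm (i) : MeasurableSet (A i) := (g.measurableSet_preimage _).inter (measurableSet_annulus _)
  have hAb (i) : A i ⊆ band n K := fun ξ hξ => Set.mem_iUnion₂.2 ⟨i.2.1, i.2.2, hξ.2⟩
  have hfin : Finite {i : g.range × Finset.Icc (-K : ℤ) K // volume (A i) ≠ 0} := inferInstance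
  let ν := Fin (Nat.card {i : g.range × Finset.Icc (-K : ℤ) K // volume (A i) ≠ 0})
  let φ : ν ≃ {i : g.range × Finset.Icc (-K : ℤ) K // volume (A i) ≠ 0} :=
    (Finite.equivFin _).symm
  refine ⟨ν, inferInstance, fun i => A (φ i).1, fun i => (φ i).1.2.1, fun i => hAm _, ?_,
    fun i => (φ i).2, fun i => Set.inter_subset_right, fun i => hAb _, ?_, ?_⟩
  · intro i j hij
    have hne : (φ i).1 ≠ (φ j).1 := fun h => hij (φ.injective (Subtype.ext h))
    refine Set.disjoint_left.2 fun ξ h1 h2 => hne (Prod.ext (Subtype.ext ?_) (Subtype.ext ?_))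
    · exact h1.1.symm.trans h2.1
    · by_contra hk
      exact Set.disjoint_left.1 (disjoint_annulus hk) h1.2 h2.2
  · intro i ξ hξ η hη
    have h1 := hg ξ (band_subset_closedBall K (hAb _ hξ))
    have h2 := hg η (band_subset_closedBall K (hAb _ hη))
    rw [show g ξ = (φ i).1.1.1 from hξ.1] at h1
    rw [show g η = (φ i).1.1.1 from hη.1] at h2
    calc dist ξ η ≤ dist (φ i).1.1.1 ξ + dist (φ i).1.1.1 η := dist_triangle_left _ _ _
      _ < ε := by linarith
  · refine Filter.EventuallyLE.antisymm
      (Filter.Eventually.of_forall fun ξ hξ => ?_) ?_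
    · obtain ⟨i, hi⟩ := Set.mem_iUnion.1 hξ
      exact hAb _ hi
    · have h0 : ∀ i, ∀ᵐ ξ : EuclideanSpace ℝ (Fin n), volume (A i) = 0 → ξ ∉ A i := fun i => by
        by_cases h : volume (A i) = 0
        · exact (measure_eq_zero_iff_ae_notMem.1 h).mono fun ξ hξ _ => hξ
        · exact Filter.Eventually.of_forall fun ξ h' => absurd h' h
      filter_upwards [ae_all_iff.2 h0] with ξ hξ hb
      obtain ⟨k, hk, hξk⟩ := Set.mem_iUnion₂.1 hb
      have hmem : ξ ∈ A ⟨⟨g ξ, g.mem_range_self ξ⟩, ⟨k, hk⟩⟩ := ⟨rfl, hξk⟩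
      refine Set.mem_iUnion.2 ⟨φ.symm ⟨_, fun h => hξ _ h hmem⟩, ?_⟩
      rw [Equiv.apply_symm_apply]
      exact hmem

end Cells

section Limit

variable {n : ℕ} {X Y : Type*} [NormedAddCommGroup X] [NormedSpace ℂ X] [CompleteSpace X]
  [NormedAddCommGroup Y] [NormedSpace ℂ Y] [CompleteSpace Y]
  {m : EuclideanSpace ℝ (Fin n) → (X →L[ℂ] Y)}

omit [CompleteSpace X] [CompleteSpace Y] in
lemma stronglyMeasurable_symbol_apply (hm : ∀ x : X, StronglyMeasurable (fun ξ => m ξ x))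
    {F : EuclideanSpace ℝ (Fin n) → X} (hF : StronglyMeasurable F) :
    StronglyMeasurable (fun ξ => m ξ (F ξ)) := by
  have hs (g : SimpleFunc (EuclideanSpace ℝ (Fin n)) X) :
      StronglyMeasurable (fun ξ => m ξ (g ξ)) := by
    induction g using SimpleFunc.induction with
    | const c hs =>
      rename_i s
      convert (hm c).indicator hs using 1
      ext ξ
      by_cases h : ξ ∈ s <;> simp [h]
    | add _ h1 h2 =>
      simp only [SimpleFunc.coe_add, Pi.add_apply, map_add]
      exact h1.add h2
  exact stronglyMeasurable_of_tendsto Filter.atTop (fun k => hs (hF.approx k))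
    (tendsto_pi_nhds.2 fun ξ => ((m ξ).continuous.tendsto _).comp (hF.tendsto_approx ξ))

omit [CompleteSpace Y] in
lemma cellOperator_eq_sum_average {ι : Type} [Fintype ι] {E : ι → Set (EuclideanSpace ℝ (Fin n))}
    (hE : ∀ i, MeasurableSet (E i)) (hE' : ∀ i, volume (E i) ≠ ∞)
    {f : EuclideanSpace ℝ (Fin n) → X} (hf : Integrable f) (x : EuclideanSpace ℝ (Fin n)) :
    cellOperator m E f x = ∑ i, ∫ ξ in E i,
      m ξ ((⨍ η in E i, (Real.fourierChar (inner ℝ η x) : ℂ)) • ⨍ η in E i, 𝓕 f η) := by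
  refine Finset.sum_congr rfl fun i _ => ?_
  have h1 (g : EuclideanSpace ℝ (Fin n) → Y) :
      ∫ ξ, g ξ ∂(ProbabilityTheory.cond volume (E i)) = (volume.real (E i))⁻¹ • ∫ ξ in E i, g ξ := by
    rw [ProbabilityTheory.cond, integral_smul_measure, ENNReal.toReal_inv, measureReal_def]
  rw [integral_cellKernel_smul (hE i) (hE' i) hf, h1, setAverage_eq, setAverage_eq, cellKernel]
  simp only [map_smul, inner_neg_right, neg_neg, integral_smul, ContinuousLinearMap.map_smul_of_tower]
  set a := ∫ ξ in E i, m ξ (∫ η in E i, 𝓕 f η)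
  set z := ∫ ξ in E i, (Real.fourierChar (inner ℝ ξ x) : ℂ)
  have h2 : (√(volume.real (E i)))⁻¹ * (√(volume.real (E i)))⁻¹ = (volume.real (E i))⁻¹ := by
    rw [← mul_inv, Real.mul_self_sqrt measureReal_nonneg]
  rw [← Complex.real_smul, smul_assoc, smul_comm (volume.real (E i))⁻¹ _ a, smul_comm z, smul_smul,
    h2, smul_assoc]

lemma norm_setAverage_sub_le {G : Type*} [NormedAddCommGroup G] [NormedSpace ℝ G] [CompleteSpace G]
    {E : Set (EuclideanSpace ℝ (Fin n))} (hE : MeasurableSet E) (hE0 : volume E ≠ 0)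
    (hE' : volume E ≠ ∞) {F : EuclideanSpace ℝ (Fin n) → G} (hF : IntegrableOn F E) {c : G} {δ : ℝ}
    (h : ∀ η ∈ E, ‖F η - c‖ ≤ δ) : ‖(⨍ η in E, F η) - c‖ ≤ δ := by
  rw [← dist_eq_norm, ← Metric.mem_closedBall]
  refine (convex_closedBall c δ).set_average_mem Metric.isClosed_closedBall hE0 hE' ?_ hF
  filter_upwards [ae_restrict_mem hE] with η hη
  simpa [dist_eq_norm] using h η hη

omit [CompleteSpace Y] in
lemma norm_sum_setIntegral_average_sub_le {ι : Type} [Fintype ι]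
    {E : ι → Set (EuclideanSpace ℝ (Fin n))} {S : Set (EuclideanSpace ℝ (Fin n))}
    (hE : ∀ i, MeasurableSet (E i)) (hd : Pairwise (Function.onFun Disjoint E))
    (hE0 : ∀ i, volume (E i) ≠ 0) (hS : ⋃ i, E i =ᵐ[volume] S) (hES : ∀ i, E i ⊆ S)
    (hS' : volume S ≠ ∞)
    (hm : ∀ x : X, StronglyMeasurable (fun ξ => m ξ x)) {M : ℝ} (hM : 0 ≤ M)
    (hmM : ∀ ξ ∈ S, ∀ v, ‖m ξ v‖ ≤ M * ‖v‖) {F : EuclideanSpace ℝ (Fin n) → X}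
    (hF : Continuous F) {B : ℝ} (hFB : ∀ ξ, ‖F ξ‖ ≤ B) {e : EuclideanSpace ℝ (Fin n) → ℂ}
    (he : Continuous e) (he1 : ∀ ξ, ‖e ξ‖ ≤ 1) {δ : ℝ}
    (hFδ : ∀ i, ∀ ξ ∈ E i, ∀ η ∈ E i, ‖F η - F ξ‖ ≤ δ)
    (heδ : ∀ i, ∀ ξ ∈ E i, ∀ η ∈ E i, ‖e η - e ξ‖ ≤ δ) :
    ‖(∑ i, ∫ ξ in E i, m ξ ((⨍ η in E i, e η) • ⨍ η in E i, F η)) - ∫ ξ in S, e ξ • m ξ (F ξ)‖ ≤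
      M * (δ * (1 + B)) * volume.real S := by
  have hE' (i) : volume (E i) ≠ ∞ := measure_ne_top_of_subset (hES i) hS'
  have hFi (i) : IntegrableOn F (E i) :=
    .of_bound (hE' i).lt_top hF.aestronglyMeasurable B (.of_forall hFB)
  have hei (i) : IntegrableOn e (E i) :=
    .of_bound (hE' i).lt_top he.aestronglyMeasurable 1 (.of_forall he1)
  have hFm := hF.stronglyMeasurable
  have hint (G : EuclideanSpace ℝ (Fin n) → X) (hG : StronglyMeasurable G) (D : ℝ)
      (hD : ∀ ξ, ‖G ξ‖ ≤ D) (i) : IntegrableOn (fun ξ => m ξ (G ξ)) (E i) := by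
    refine .of_bound (hE' i).lt_top (stronglyMeasurable_symbol_apply hm hG).aestronglyMeasurable
      (M * D) ?_
    filter_upwards [ae_restrict_mem (hE i)] with ξ hξ
    exact (hmM ξ (hES i hξ) _).trans (mul_le_mul_of_nonneg_left (hD ξ) hM)
  have hI2 (i) : IntegrableOn (fun ξ => m ξ (e ξ • F ξ)) (E i) :=
    hint (fun ξ => e ξ • F ξ) (he.smul hF).stronglyMeasurable B (fun ξ => by
      rw [norm_smul]
      exact (mul_le_of_le_one_left (norm_nonneg _) (he1 ξ)).trans (hFB ξ)) i
  have hI1 (i) (v : X) : IntegrableOn (fun ξ => m ξ v) (E i) :=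
    hint (fun _ => v) stronglyMeasurable_const ‖v‖ (fun _ => le_rfl) i
  simp only [← map_smul]
  rw [← setIntegral_congr_set hS, integral_iUnion_fintype hE hd hI2, ← Finset.sum_sub_distrib]
  rw [← measureReal_congr hS, measureReal_iUnion_fintype hd hE hE', Finset.mul_sum]
  refine (norm_sum_le _ _).trans (Finset.sum_le_sum fun i _ => ?_)
  rw [← integral_sub (hI1 i _) (hI2 i)]
  refine norm_setIntegral_le_of_norm_le_const (hE' i).lt_top fun ξ hξ => ?_
  rw [← map_sub]
  refine (hmM ξ (hES i hξ) _).trans (mul_le_mul_of_nonneg_left ?_ hM)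
  have h1 : ‖(⨍ η in E i, F η) - F ξ‖ ≤ δ :=
    norm_setAverage_sub_le (hE i) (hE0 i) (hE' i) (hFi i) (hFδ i ξ hξ)
  have h2 : ‖(⨍ η in E i, e η) - e ξ‖ ≤ δ :=
    norm_setAverage_sub_le (hE i) (hE0 i) (hE' i) (hei i) (heδ i ξ hξ)
  have h3 : ‖⨍ η in E i, e η‖ ≤ 1 := by
    simpa using norm_setAverage_sub_le (c := 0) (hE i) (hE0 i) (hE' i) (hei i)
      (fun η _ => by simpa using he1 η)
  have h4 : (⨍ η in E i, e η) • (⨍ η in E i, F η) - e ξ • F ξ =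
      (⨍ η in E i, e η) • ((⨍ η in E i, F η) - F ξ) + ((⨍ η in E i, e η) - e ξ) • F ξ := by
    rw [smul_sub, sub_smul]; abel
  have hδ : 0 ≤ δ := (norm_nonneg _).trans h1
  rw [h4]
  refine (norm_add_le _ _).trans ?_
  rw [norm_smul, norm_smul, mul_add, mul_one]
  exact add_le_add ((mul_le_of_le_one_left (norm_nonneg _) h3).trans h1)
    (mul_le_mul h2 (hFB ξ) (norm_nonneg _) hδ)

lemma exists_norm_symbol_apply_le_on_band {ρ a : ℝ} (hρ : 0 ≤ ρ) (ha : 0 ≤ a)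
    (hR : ∀ (N : ℕ) (ξ : Fin N → EuclideanSpace ℝ (Fin n)) (_ : ∀ i, ξ i ≠ 0) (x : Fin N → X),
      Real.sqrt (radAvg N fun ε => ‖∑ i, radSign (ε i) • ((‖ξ i‖ ^ a) • m (ξ i)) (x i)‖ ^ 2) ≤
        ρ * Real.sqrt (radAvg N fun ε => ‖∑ i, radSign (ε i) • x i‖ ^ 2)) (K : ℕ) :
    ∃ M, 0 ≤ M ∧ ∀ ξ ∈ band n K, ∀ v, ‖m ξ v‖ ≤ M * ‖v‖ := by
  refine ⟨ρ * (2 : ℝ) ^ (a * K), by positivity, fun ξ hξ v => ?_⟩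
  obtain ⟨k, hk, hξ⟩ := Set.mem_iUnion₂.1 hξ
  refine (norm_symbol_apply_le_of_mem_annulus hρ ha hR hξ v).trans ?_
  gcongr
  · norm_num
  · rw [← mul_neg]
    refine mul_le_mul_of_nonneg_left ?_ ha
    have : (-K : ℝ) ≤ k := by exact_mod_cast (Finset.mem_Icc.1 hk).1
    linarith

omit [CompleteSpace X] in
lemma continuous_fourier_of_integrable {f : EuclideanSpace ℝ (Fin n) → X} (hf : Integrable f) :
    Continuous (𝓕 f) :=
  VectorFourier.fourierIntegral_continuous Real.continuous_fourierChar continuous_inner hf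

omit [CompleteSpace X] in
lemma norm_fourier_le_integral_norm (f : EuclideanSpace ℝ (Fin n) → X)
    (ξ : EuclideanSpace ℝ (Fin n)) : ‖𝓕 f ξ‖ ≤ ∫ x, ‖f x‖ :=
  VectorFourier.norm_fourierIntegral_le_integral_norm _ _ _ _ _

omit [CompleteSpace X] [CompleteSpace Y] in
lemma continuous_cellOperator {ι : Type} [Fintype ι] {E : ι → Set (EuclideanSpace ℝ (Fin n))}
    (hE : ∀ i, volume (E i) ≠ ∞) (f : EuclideanSpace ℝ (Fin n) → X) :
    Continuous (cellOperator m E f) :=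
  continuous_finsetSum _ fun i _ =>
    ((continuous_cellKernel (E i) (hE i)).comp continuous_neg).smul continuous_const

omit [CompleteSpace Y] in
/-- The truncated multiplier integrals are limits of cell operators. -/
lemma exists_tendsto_cellOperator (hm : ∀ x : X, StronglyMeasurable (fun ξ => m ξ x)) {K : ℕ} {M : ℝ}
    (hM : 0 ≤ M) (hmM : ∀ ξ ∈ band n K, ∀ v, ‖m ξ v‖ ≤ M * ‖v‖)
    {f : EuclideanSpace ℝ (Fin n) → X} (hf : Integrable f) {D r : ℝ≥0∞}
    (hD : ∀ {ι : Type} [Fintype ι] (E : ι → Set (EuclideanSpace ℝ (Fin n))) (b : ι → ℤ),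
      (∀ i, MeasurableSet (E i)) → Pairwise (Function.onFun Disjoint E) → (∀ i, volume (E i) ≠ 0) →
      (∀ i, E i ⊆ annulus n (b i)) → eLpNorm (cellOperator m E f) r volume ≤ D) :
    ∃ T : ℕ → EuclideanSpace ℝ (Fin n) → Y, (∀ j, Continuous (T j)) ∧
      (∀ j, eLpNorm (T j) r volume ≤ D) ∧ ∀ x, Filter.Tendsto (fun j => T j x) Filter.atTop
        (nhds (∫ ξ in band n K, (Real.fourierChar (inner ℝ ξ x) : ℂ) • m ξ (𝓕 f ξ))) := by
  choose ι hι E b hE hd hE0 hEa hEb hdiam hS using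
    fun j : ℕ => exists_cells (n := n) K (Nat.one_div_pos_of_nat (α := ℝ) (n := j))
  have hE' (j i) : volume (E j i) ≠ ∞ :=
    measure_ne_top_of_subset (hEb j i) (volume_band_ne_top K)
  refine ⟨fun j => cellOperator m (E j) f, fun j => continuous_cellOperator (hE' j) f,
    fun j => hD (E j) (b j) (hE j) (hd j) (hE0 j) (hEa j), fun x => ?_⟩
  have hF := continuous_fourier_of_integrable hf
  have he : Continuous fun ξ : EuclideanSpace ℝ (Fin n) => (Real.fourierChar (inner ℝ ξ x) : ℂ) :=
    continuous_subtype_val.comp (Real.continuous_fourierChar.comp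
      (continuous_id.inner continuous_const))
  have he1 (ξ : EuclideanSpace ℝ (Fin n)) : ‖(Real.fourierChar (inner ℝ ξ x) : ℂ)‖ ≤ 1 :=
    (Circle.norm_coe _).le
  set B := ∫ x, ‖f x‖
  have hB : 0 ≤ B := integral_nonneg fun _ => norm_nonneg _
  set A := M * (1 + B) * volume.real (band n K) with hA
  have hA0 : 0 ≤ A := by positivity
  have hcpt := isCompact_closedBall (0 : EuclideanSpace ℝ (Fin n)) ((2 : ℝ) ^ (K + 1 : ℝ))
  have hsub := band_subset_closedBall (n := n) K
  rw [Metric.tendsto_atTop]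
  intro η hη
  have hδ : 0 < η / (A + 1) := by positivity
  obtain ⟨d₁, hd₁, h₁⟩ := Metric.uniformContinuousOn_iff.1
    (hcpt.uniformContinuousOn_of_continuous hF.continuousOn) _ hδ
  obtain ⟨d₂, hd₂, h₂⟩ := Metric.uniformContinuousOn_iff.1
    (hcpt.uniformContinuousOn_of_continuous he.continuousOn) _ hδ
  obtain ⟨N, hN⟩ := exists_nat_one_div_lt (lt_min hd₁ hd₂)
  refine ⟨N, fun j hj => ?_⟩
  have hjN : 1 / ((j : ℝ) + 1) < min d₁ d₂ := (Nat.one_div_le_one_div hj).trans_lt hN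
  have hmem (i) {ξ} (hξ : ξ ∈ E j i) := hsub (hEb j i hξ)
  beta_reduce
  rw [dist_eq_norm, cellOperator_eq_sum_average (hE j) (hE' j) hf]
  refine (norm_sum_setIntegral_average_sub_le (δ := η / (A + 1)) (hE j) (hd j) (hE0 j) (hS j) (hEb j)
    (volume_band_ne_top K) hm hM hmM hF (norm_fourier_le_integral_norm f) he he1
    (fun i ξ hξ ζ hζ => ?_) (fun i ξ hξ ζ hζ => ?_)).trans_lt ?_
  · rw [← dist_eq_norm]
    exact (h₁ _ (hmem i hζ) _ (hmem i hξ)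
      ((hdiam j i ζ hζ ξ hξ).trans (hjN.trans_le (min_le_left _ _)))).le
  · rw [← dist_eq_norm]
    exact (h₂ _ (hmem i hζ) _ (hmem i hξ)
      ((hdiam j i ζ hζ ξ hξ).trans (hjN.trans_le (min_le_right _ _)))).le
  · calc M * (η / (A + 1) * (1 + B)) * volume.real (band n K) = η * (A / (A + 1)) := by
          rw [hA]; ring
      _ < η * 1 := by
          gcongr
          rw [div_lt_one (by positivity)]
          linarith
      _ = η := mul_one η

lemma eLpNorm_le_of_tendsto {G : Type*} [NormedAddCommGroup G]
    {T : ℕ → EuclideanSpace ℝ (Fin n) → G} {g : EuclideanSpace ℝ (Fin n) → G} {r D : ℝ≥0∞}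
    (hT : ∀ j, AEStronglyMeasurable (T j) volume) (hD : ∀ j, eLpNorm (T j) r volume ≤ D)
    (h : ∀ x, Filter.Tendsto (fun j => T j x) Filter.atTop (nhds (g x))) :
    eLpNorm g r volume ≤ D := by
  refine (Lp.eLpNorm_lim_le_liminf_eLpNorm hT g (.of_forall h)).trans ?_
  exact Filter.liminf_le_of_frequently_le' (Filter.Frequently.of_forall hD)

omit [CompleteSpace Y] in
/-- A bound for the cell operators, uniform in the cells, passes to the multiplier operator. -/
lemma eLpNorm_fourierInv_symbol_le (hn : 0 < n)
    (hm : ∀ x : X, StronglyMeasurable (fun ξ => m ξ x))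
    (hmb : ∀ K : ℕ, ∃ M, 0 ≤ M ∧ ∀ ξ ∈ band n K, ∀ v, ‖m ξ v‖ ≤ M * ‖v‖)
    {f : EuclideanSpace ℝ (Fin n) → X} (hf : Integrable f) {D r : ℝ≥0∞}
    (hD : ∀ {ι : Type} [Fintype ι] (E : ι → Set (EuclideanSpace ℝ (Fin n))) (b : ι → ℤ),
      (∀ i, MeasurableSet (E i)) → Pairwise (Function.onFun Disjoint E) → (∀ i, volume (E i) ≠ 0) →
      (∀ i, E i ⊆ annulus n (b i)) → eLpNorm (cellOperator m E f) r volume ≤ D) :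
    eLpNorm (𝓕⁻ (fun ξ => m ξ (𝓕 f ξ))) r volume ≤ D := by
  have hconv (x : EuclideanSpace ℝ (Fin n)) :
      Integrable (fun ξ => Real.fourierChar (inner ℝ ξ x) • m ξ (𝓕 f ξ)) ↔
        Integrable (fun ξ => m ξ (𝓕 f ξ)) := by
    simpa using Real.fourierIntegral_convergent_iff (f := fun ξ => m ξ (𝓕 f ξ)) (-x)
  by_cases hint : Integrable (fun ξ => m ξ (𝓕 f ξ))
  swap
  · have h0 : 𝓕⁻ (fun ξ => m ξ (𝓕 f ξ)) = 0 := by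
      ext x
      rw [Real.fourierInv_eq]
      exact integral_undef fun h => hint ((hconv x).1 h)
    simp [h0]
  have : Nonempty (Fin n) := ⟨⟨0, hn⟩⟩
  have hk (K : ℕ) : AEStronglyMeasurable (fun x => ∫ ξ in band n K,
      (Real.fourierChar (inner ℝ ξ x) : ℂ) • m ξ (𝓕 f ξ)) volume ∧
      eLpNorm (fun x => ∫ ξ in band n K,
      (Real.fourierChar (inner ℝ ξ x) : ℂ) • m ξ (𝓕 f ξ)) r volume ≤ D := by
    obtain ⟨M, hM, hmM⟩ := hmb K
    obtain ⟨T, hT, hTD, hlim⟩ := exists_tendsto_cellOperator hm hM hmM hf hD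
    have hT' (j) : AEStronglyMeasurable (T j) volume := (hT j).aestronglyMeasurable
    exact ⟨aestronglyMeasurable_of_tendsto_ae Filter.atTop hT' (.of_forall hlim),
      eLpNorm_le_of_tendsto hT' hTD hlim⟩
  refine eLpNorm_le_of_tendsto (fun K => (hk K).1) (fun K => (hk K).2) fun x => ?_
  have hint' : Integrable fun ξ => (Real.fourierChar (inner ℝ ξ x) : ℂ) • m ξ (𝓕 f ξ) := (hconv x).2 hint
  have hU : (⋃ K, band n K) =ᵐ[volume] (Set.univ : Set (EuclideanSpace ℝ (Fin n))) := by
    filter_upwards [compl_mem_ae_iff.2 (measure_singleton (0 : EuclideanSpace ℝ (Fin n)))] with ξ hξ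
    exact eq_true (Set.mem_iUnion.2 (exists_mem_band hξ)) |>.trans (eq_true trivial).symm
  have h := tendsto_setIntegral_of_monotone (fun K => measurableSet_band (n := n) K) monotone_band
    hint'.integrableOn
  rw [setIntegral_congr_set hU, setIntegral_univ] at h
  rw [Real.fourierInv_eq]
  exact h

end Limit

section DimZero

variable {X Y : Type*} [NormedAddCommGroup X] [NormedSpace ℂ X] [CompleteSpace X]
  [NormedAddCommGroup Y] [NormedSpace ℂ Y] [CompleteSpace Y]

lemma eLpNorm_fourierInv_symbol_le_of_dim_zero {p q : ℝ} (hp : 0 < p) (hq : 0 < q)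
    (m : EuclideanSpace ℝ (Fin 0) → (X →L[ℂ] Y)) (f : EuclideanSpace ℝ (Fin 0) → X) :
    eLpNorm (𝓕⁻ (fun ξ => m ξ (𝓕 f ξ))) (ENNReal.ofReal q) volume ≤
      ENNReal.ofReal ‖m 0‖ * eLpNorm f (ENNReal.ofReal p) volume := by
  have h1 : 𝓕⁻ (fun ξ => m ξ (𝓕 f ξ)) = fun _ => m 0 (f 0) := by
    ext x
    simp [Real.fourierInv_eq, Real.fourier_eq, volume_euclideanSpace_eq_dirac]
  have h2 : f = fun _ => f 0 := funext fun x => congrArg f (Subsingleton.elim _ _)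
  rw [h1, h2, eLpNorm_const _ (by simpa using hq) (NeZero.ne _),
    eLpNorm_const _ (by simpa using hp) (NeZero.ne _)]
  simp only [volume_euclideanSpace_eq_dirac, measure_univ, one_rpow, mul_one,
    ofReal_norm]
  exact (m 0).le_opENorm _

end DimZero

end Multiplier

/-- Operator-valued `(L^p, L^q)` Fourier multiplier theorem under type and
cotype assumptions: if `X` has type `p₀ ∈ (1,2]`, `Y` has cotype `q₀ ∈ [2,∞)`,
`p ∈ (1,p₀)` and `q ∈ (q₀,∞)` (with `p = p₀` allowed if `p₀ = 2` and `q = q₀` allowed if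
`q₀ = 2`), and the set `{ |ξ|^{n(1/p−1/q)} m(ξ) : ξ ≠ 0 }` is R-bounded, then `m` is a
bounded `(L^p, L^q)` Fourier multiplier. -/
theorem type_cotype_LpLq_multiplier (n : ℕ)
    {X Y : Type*} [NormedAddCommGroup X] [NormedSpace ℂ X] [CompleteSpace X]
    [NormedAddCommGroup Y] [NormedSpace ℂ Y] [CompleteSpace Y]
    (p₀ q₀ p q : ℝ) (hp₀1 : 1 < p₀) (hp₀2 : p₀ ≤ 2) (hq₀ : 2 ≤ q₀)
    (hp : 1 < p) (hp' : p < p₀ ∨ (p = p₀ ∧ p₀ = 2))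
    (hq' : q₀ < q ∨ (q = q₀ ∧ q₀ = 2))
    (τ : ℝ) (hτ : 0 ≤ τ)
    -- X has type p₀ with constant τ:
    (hType : ∀ (N : ℕ) (x : Fin N → X),
      Real.sqrt (radAvg N fun ε => ‖∑ i, radSign (ε i) • x i‖ ^ 2) ≤
        τ * (∑ i, ‖x i‖ ^ p₀) ^ (1 / p₀))
    (κ : ℝ) (hκ : 0 ≤ κ)
    -- Y has cotype q₀ with constant κ:
    (hCotype : ∀ (N : ℕ) (y : Fin N → Y),
      (∑ i, ‖y i‖ ^ q₀) ^ (1 / q₀) ≤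
        κ * Real.sqrt (radAvg N fun ε => ‖∑ i, radSign (ε i) • y i‖ ^ 2))
    (m : EuclideanSpace ℝ (Fin n) → (X →L[ℂ] Y))
    (hm : ∀ x : X, StronglyMeasurable (fun ξ => m ξ x))
    (ρ : ℝ) (hρ : 0 ≤ ρ)
    -- the set { |ξ|^{n(1/p−1/q)} m(ξ) : ξ ≠ 0 } is R-bounded with constant ρ:
    (hR : ∀ (N : ℕ) (ξ : Fin N → EuclideanSpace ℝ (Fin n)) (_ : ∀ i, ξ i ≠ 0)
      (x : Fin N → X),
      Real.sqrt (radAvg N fun ε =>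
          ‖∑ i, radSign (ε i) •
            ((‖ξ i‖ ^ ((n : ℝ) * (1 / p - 1 / q))) • m (ξ i)) (x i)‖ ^ 2) ≤
        ρ * Real.sqrt (radAvg N fun ε => ‖∑ i, radSign (ε i) • x i‖ ^ 2)) :
    ∃ C : ℝ, 0 ≤ C ∧ ∀ f : SchwartzMap (EuclideanSpace ℝ (Fin n)) X,
      eLpNorm (𝓕⁻ (fun ξ => m ξ (𝓕 (⇑f) ξ))) (ENNReal.ofReal q) volume ≤
        ENNReal.ofReal C * eLpNorm (⇑f) (ENNReal.ofReal p) volume := by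
  rcases Nat.eq_zero_or_pos n with rfl | hn
  · exact ⟨‖m 0‖, norm_nonneg _, fun f => eLpNorm_fourierInv_symbol_le_of_dim_zero
      (by linarith) (by rcases hq' with h | ⟨h, -⟩ <;> linarith) m f⟩
  have hType' : HasGaussType X p₀ (ENNReal.ofReal τ) := fun b x =>
    gaussNorm_le_of_type (by linarith) hp₀2 hτ hType b x
  have hCotype' : HasGaussCotype Y q₀ (ENNReal.ofReal κ) := fun b y =>
    gaussNorm_ge_of_cotype hq₀ hκ hCotype b y
  have ha : 0 ≤ (n : ℝ) * (1 / p - 1 / q) := by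
    have hpq : p ≤ q := by
      rcases hp' with h | ⟨h, -⟩ <;> rcases hq' with h' | ⟨h', -⟩ <;> linarith
    exact mul_nonneg (by positivity) (sub_nonneg.2 (one_div_le_one_div_of_le (by linarith) hpq))
  obtain ⟨C, hC, h⟩ := exists_eLpNorm_cellOperator_le hn hp₀2 hq₀ hp hp' hq' ENNReal.ofReal_ne_top
    hType' ENNReal.ofReal_ne_top hCotype' hρ hm hR
  refine ⟨C.toReal, ENNReal.toReal_nonneg, fun f => ?_⟩
  rw [ENNReal.ofReal_toReal hC]
  exact eLpNorm_fourierInv_symbol_le hn hm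
    (exists_norm_symbol_apply_le_on_band hρ ha hR) f.integrable fun E b hE hd hE0 hEa =>
      h E b f hE hd hE0 hEa f.integrable f.continuous.stronglyMeasurable (f.memLp _ _).eLpNorm_ne_top
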